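/- arXiv:2101.09024 — 4 statements merged into one kernel-verified Lean document; each statement's English description precedes it below -/
import Mathlib

section
/- There exist a real constant c < 4 and a valid online translation strategy σ such that for every nonempty finite stream L of pieces, ALG_σ(L) ≤ c·OPT(L). (Competitive ratio strictly less than 4 for online perimeter minimization with translations only.) -/
open Set

/-- A piece is a pair (w,h) of (intended positive) real numbers. -/
abbrev Piece := ℝ × ℝ

/-- Both edge lengths of the piece are positive. -/
def PiecePos (p : Piece) : Prop := 0 < p.1 ∧ 0 < p.2

/-- The axis-parallel closed rectangle obtained by placing piece `p` by
translation at the point `q`. -/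
def placedRect (p : Piece) (q : ℝ × ℝ) : Set (ℝ × ℝ) :=
  Set.Icc q.1 (q.1 + p.1) ×ˢ Set.Icc q.2 (q.2 + p.2)

/-- Width of the axis-parallel bounding box of a set in the plane. -/
noncomputable def boxWidth (S : Set (ℝ × ℝ)) : ℝ :=
  sSup (Prod.fst '' S) - sInf (Prod.fst '' S)

/-- Height of the axis-parallel bounding box of a set in the plane. -/
noncomputable def boxHeight (S : Set (ℝ × ℝ)) : ℝ :=
  sSup (Prod.snd '' S) - sInf (Prod.snd '' S)

/-! ### Translations only -/

/-- `pos` is a packing (by translations) of the list `L` of pieces: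
the placed rectangles have pairwise disjoint interiors. -/
def IsPacking (L : List Piece) (pos : Fin L.length → ℝ × ℝ) : Prop :=
  ∀ i j : Fin L.length, i ≠ j →
    Disjoint (interior (placedRect (L.get i) (pos i)))
             (interior (placedRect (L.get j) (pos j)))

/-- The union of the placed rectangles. -/
def packedSet (L : List Piece) (pos : Fin L.length → ℝ × ℝ) : Set (ℝ × ℝ) :=
  ⋃ i : Fin L.length, placedRect (L.get i) (pos i)

/-- Perimeter of the bounding box of a packing. -/
noncomputable def periCost (L : List Piece) (pos : Fin L.length → ℝ × ℝ) : ℝ :=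
  2 * (boxWidth (packedSet L pos) + boxHeight (packedSet L pos))

/-- Area of the bounding box of a packing. -/
noncomputable def areaCost (L : List Piece) (pos : Fin L.length → ℝ × ℝ) : ℝ :=
  boxWidth (packedSet L pos) * boxHeight (packedSet L pos)

/-- Optimal offline bounding-box perimeter for the pieces of `L`. -/
noncomputable def optPeri (L : List Piece) : ℝ :=
  sInf { c | ∃ pos : Fin L.length → ℝ × ℝ, IsPacking L pos ∧ periCost L pos = c }

/-- Optimal offline bounding-box area for the pieces of `L`. -/
noncomputable def optArea (L : List Piece) : ℝ :=
  sInf { c | ∃ pos : Fin L.length → ℝ × ℝ, IsPacking L pos ∧ areaCost L pos = c }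

/-- The positions chosen by the online strategy `σ` on the stream `L`:
the `i`-th piece is placed at the point chosen by `σ` as a function of the
first `i+1` pieces. -/
def onlinePos (σ : List Piece → ℝ × ℝ) (L : List Piece) :
    Fin L.length → ℝ × ℝ :=
  fun i => σ (L.take ((i : ℕ) + 1))

/-- `σ` is a valid online translation strategy: on every stream of pieces it
produces a packing. -/
def StrategyValid (σ : List Piece → ℝ × ℝ) : Prop :=
  ∀ L : List Piece, (∀ p ∈ L, PiecePos p) → IsPacking L (onlinePos σ L)

/-- Perimeter of the bounding box of the packing produced by `σ` on `L`. -/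
noncomputable def algPeri (σ : List Piece → ℝ × ℝ) (L : List Piece) : ℝ :=
  periCost L (onlinePos σ L)

/-- Area of the bounding box of the packing produced by `σ` on `L`. -/
noncomputable def algArea (σ : List Piece → ℝ × ℝ) (L : List Piece) : ℝ :=
  areaCost L (onlinePos σ L)

/-! ### Rotations by 90° allowed -/

/-- The piece `p` in the orientation given by `r`: rotated by 90° if `r` is
`true`. -/
def orient (p : Piece) (r : Bool) : Piece := if r then (p.2, p.1) else p

/-- `pos, rot` is a packing with rotations of the list `L` of pieces. -/
def IsRotPacking (L : List Piece) (pos : Fin L.length → ℝ × ℝ)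
    (rot : Fin L.length → Bool) : Prop :=
  ∀ i j : Fin L.length, i ≠ j →
    Disjoint (interior (placedRect (orient (L.get i) (rot i)) (pos i)))
             (interior (placedRect (orient (L.get j) (rot j)) (pos j)))

/-- The union of the placed (possibly rotated) rectangles. -/
def packedRotSet (L : List Piece) (pos : Fin L.length → ℝ × ℝ)
    (rot : Fin L.length → Bool) : Set (ℝ × ℝ) :=
  ⋃ i : Fin L.length, placedRect (orient (L.get i) (rot i)) (pos i)

/-- Perimeter of the bounding box of a packing with rotations. -/
noncomputable def periRotCost (L : List Piece) (pos : Fin L.length → ℝ × ℝ)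
    (rot : Fin L.length → Bool) : ℝ :=
  2 * (boxWidth (packedRotSet L pos rot) + boxHeight (packedRotSet L pos rot))

/-- Area of the bounding box of a packing with rotations. -/
noncomputable def areaRotCost (L : List Piece) (pos : Fin L.length → ℝ × ℝ)
    (rot : Fin L.length → Bool) : ℝ :=
  boxWidth (packedRotSet L pos rot) * boxHeight (packedRotSet L pos rot)

/-- Optimal offline bounding-box perimeter with rotations allowed. -/
noncomputable def optRotPeri (L : List Piece) : ℝ :=
  sInf { c | ∃ (pos : Fin L.length → ℝ × ℝ) (rot : Fin L.length → Bool),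
    IsRotPacking L pos rot ∧ periRotCost L pos rot = c }

/-- Optimal offline bounding-box area with rotations allowed. -/
noncomputable def optRotArea (L : List Piece) : ℝ :=
  sInf { c | ∃ (pos : Fin L.length → ℝ × ℝ) (rot : Fin L.length → Bool),
    IsRotPacking L pos rot ∧ areaRotCost L pos rot = c }

/-- The positions chosen by the online rotation strategy `σ` on the stream `L`. -/
def onlineRotPos (σ : List Piece → (ℝ × ℝ) × Bool) (L : List Piece) :
    Fin L.length → ℝ × ℝ :=
  fun i => (σ (L.take ((i : ℕ) + 1))).1

/-- The orientations chosen by the online rotation strategy `σ` on the stream `L`. -/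
def onlineRot (σ : List Piece → (ℝ × ℝ) × Bool) (L : List Piece) :
    Fin L.length → Bool :=
  fun i => (σ (L.take ((i : ℕ) + 1))).2

/-- `σ` is a valid online rotation strategy: on every stream of pieces it
produces a packing with rotations. -/
def RotStrategyValid (σ : List Piece → (ℝ × ℝ) × Bool) : Prop :=
  ∀ L : List Piece, (∀ p ∈ L, PiecePos p) →
    IsRotPacking L (onlineRotPos σ L) (onlineRot σ L)

/-- Perimeter of the bounding box of the packing produced by `σ` on `L`. -/
noncomputable def algRotPeri (σ : List Piece → (ℝ × ℝ) × Bool) (L : List Piece) : ℝ :=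
  periRotCost L (onlineRotPos σ L) (onlineRot σ L)

/-- Area of the bounding box of the packing produced by `σ` on `L`. -/
noncomputable def algRotArea (σ : List Piece → (ℝ × ℝ) × Bool) (L : List Piece) : ℝ :=
  areaRotCost L (onlineRotPos σ L) (onlineRot σ L)

/-! ### Square pieces, bounding-square cost -/

/-- The axis-parallel closed square of side `s` placed at the point `q`. -/
def placedSq (s : ℝ) (q : ℝ × ℝ) : Set (ℝ × ℝ) :=
  Set.Icc q.1 (q.1 + s) ×ˢ Set.Icc q.2 (q.2 + s)

/-- `pos` is a packing of the list `L` of square pieces. -/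
def IsSqPacking (L : List ℝ) (pos : Fin L.length → ℝ × ℝ) : Prop :=
  ∀ i j : Fin L.length, i ≠ j →
    Disjoint (interior (placedSq (L.get i) (pos i)))
             (interior (placedSq (L.get j) (pos j)))

/-- The union of the placed squares. -/
def packedSqSet (L : List ℝ) (pos : Fin L.length → ℝ × ℝ) : Set (ℝ × ℝ) :=
  ⋃ i : Fin L.length, placedSq (L.get i) (pos i)

/-- Area of the smallest axis-parallel square containing all placed squares. -/
noncomputable def sqCost (L : List ℝ) (pos : Fin L.length → ℝ × ℝ) : ℝ :=
  (max (boxWidth (packedSqSet L pos)) (boxHeight (packedSqSet L pos))) ^ 2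

/-- Optimal offline bounding-square area for the square pieces of `L`. -/
noncomputable def optSq (L : List ℝ) : ℝ :=
  sInf { c | ∃ pos : Fin L.length → ℝ × ℝ, IsSqPacking L pos ∧ sqCost L pos = c }

/-- The positions chosen by the online strategy `σ` on the stream `L` of
square pieces. -/
def onlineSqPos (σ : List ℝ → ℝ × ℝ) (L : List ℝ) : Fin L.length → ℝ × ℝ :=
  fun i => σ (L.take ((i : ℕ) + 1))

/-- `σ` is a valid online translation strategy for square pieces. -/
def SqStrategyValid (σ : List ℝ → ℝ × ℝ) : Prop :=
  ∀ L : List ℝ, (∀ s ∈ L, 0 < s) → IsSqPacking L (onlineSqPos σ L)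

/-- Bounding-square area of the packing produced by `σ` on `L`. -/
noncomputable def algSq (σ : List ℝ → ℝ × ℝ) (L : List ℝ) : ℝ :=
  sqCost L (onlineSqPos σ L)

/-! ### Dyadic blocks -/

/-- Class `(i, j)` stands for blocks of width `2 ^ i` and height `7 / 5 * 2 ^ j`. -/
abbrev BlockClass := ℤ × ℤ

/-- Width and height of the blocks of class `c`. -/
noncomputable def blockSize (c : BlockClass) : ℝ × ℝ := (2 ^ c.1, 7 / 5 * 2 ^ c.2)

/-- Area of the blocks of class `c`. -/
noncomputable def blockArea (c : BlockClass) : ℝ := (blockSize c).1 * (blockSize c).2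

/-- The class of blocks that consist of two blocks of class `c`, joined along their longer edge. -/
def parentClass (c : BlockClass) : BlockClass :=
  if c.1 ≤ c.2 then (c.1 + 1, c.2) else (c.1, c.2 + 1)

/-- The class of the smallest block in which the piece `p` fits. -/
noncomputable def pieceClass (p : Piece) : BlockClass :=
  (Int.clog 2 p.1, Int.clog 2 (p.2 / (7 / 5)))

/-- An axis-parallel line separates the rectangles of sizes `s` and `t` with lower left
corners `q` and `r`. -/
def Separated (s q t r : ℝ × ℝ) : Prop :=
  q.1 + s.1 ≤ r.1 ∨ r.1 + t.1 ≤ q.1 ∨ q.2 + s.2 ≤ r.2 ∨ r.2 + t.2 ≤ q.2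

lemma Separated.symm {s q t r : ℝ × ℝ} (h : Separated s q t r) : Separated t r s q := by
  unfold Separated at *; tauto

lemma Separated.mono_left {s q t r s' q' : ℝ × ℝ} (h : Separated s q t r)
    (h1 : q.1 ≤ q'.1) (h2 : q.2 ≤ q'.2) (h3 : q'.1 + s'.1 ≤ q.1 + s.1)
    (h4 : q'.2 + s'.2 ≤ q.2 + s.2) : Separated s' q' t r := by
  rcases h with h | h | h | h
  · exact Or.inl (by linarith)
  · exact Or.inr (Or.inl (by linarith))
  · exact Or.inr (Or.inr (Or.inl (by linarith)))
  · exact Or.inr (Or.inr (Or.inr (by linarith)))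

lemma blockSize_fst_pos (c : BlockClass) : 0 < (blockSize c).1 := by
  simp only [blockSize]; positivity

lemma blockSize_snd_pos (c : BlockClass) : 0 < (blockSize c).2 := by
  simp only [blockSize]; positivity

lemma blockArea_pos (c : BlockClass) : 0 < blockArea c :=
  mul_pos (blockSize_fst_pos c) (blockSize_snd_pos c)

lemma blockSize_parentClass_of_le {c : BlockClass} (h : c.1 ≤ c.2) :
    blockSize (parentClass c) = (2 * (blockSize c).1, (blockSize c).2) := by
  simp only [blockSize, parentClass, if_pos h, zpow_add_one₀ (two_ne_zero' ℝ)]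
  ext
  · simp [mul_comm]
  · simp

lemma blockSize_parentClass_of_lt {c : BlockClass} (h : c.2 < c.1) :
    blockSize (parentClass c) = ((blockSize c).1, 2 * (blockSize c).2) := by
  simp only [blockSize, parentClass, if_neg (not_le.2 h), zpow_add_one₀ (two_ne_zero' ℝ)]
  ext
  · simp
  · simp; ring

lemma blockArea_parentClass (c : BlockClass) : blockArea (parentClass c) = 2 * blockArea c := by
  rcases le_or_gt c.1 c.2 with h | h
  · simp only [blockArea, blockSize_parentClass_of_le h]; ring
  · simp only [blockArea, blockSize_parentClass_of_lt h]; ring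

lemma parentClass_fst_add_snd (c : BlockClass) :
    (parentClass c).1 + (parentClass c).2 = c.1 + c.2 + 1 := by
  unfold parentClass; split_ifs <;> simp <;> ring

lemma iterate_parentClass_fst_add_snd (c : BlockClass) (k : ℕ) :
    (parentClass^[k] c).1 + (parentClass^[k] c).2 = c.1 + c.2 + k := by
  induction k with
  | zero => simp
  | succ k ih =>
    rw [Function.iterate_succ_apply', parentClass_fst_add_snd, ih]; push_cast; ring

lemma iterate_parentClass_injective (c : BlockClass) :
    Function.Injective fun k : ℕ => parentClass^[k] c := by
  intro k l h
  have h1 := iterate_parentClass_fst_add_snd c k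
  have h2 := iterate_parentClass_fst_add_snd c l
  simp only at h
  rw [h] at h1
  omega

lemma exists_iterate_parentClass_eq_zero (N : BlockClass →₀ ℕ) (c : BlockClass) :
    ∃ k : ℕ, N (parentClass^[k] c) = 0 := by
  by_contra! h
  refine Set.infinite_univ (α := ℕ) (Set.Finite.subset
    (N.support.finite_toSet.preimage (iterate_parentClass_injective c).injOn) ?_)
  intro k _
  simpa using h k

/-! ### Counting requests -/

/-- One more request for a block of class `c`. -/
noncomputable def request (N : BlockClass →₀ ℕ) (c : BlockClass) : BlockClass →₀ ℕ :=
  N + Finsupp.single c 1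

lemma le_request (N : BlockClass →₀ ℕ) (c : BlockClass) : N ≤ request N c :=
  le_self_add

lemma request_mono {N M : BlockClass →₀ ℕ} (h : N ≤ M) (c : BlockClass) :
    request N c ≤ request M c :=
  add_le_add_left h _

lemma request_apply_of_ne (N : BlockClass →₀ ℕ) {c d : BlockClass} (h : d ≠ c) :
    request N c d = N d := by
  simp [request, h.symm]

lemma request_apply_self (N : BlockClass →₀ ℕ) (c : BlockClass) :
    request N c c = N c + 1 := by
  simp [request]


/-- Total area of one block of each class that was requested an odd number of times. -/
noncomputable def oddArea (N : BlockClass →₀ ℕ) : ℝ :=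
  N.sum fun c n => if Odd n then blockArea c else 0

lemma oddArea_eq_add_erase (N : BlockClass →₀ ℕ) (c : BlockClass) :
    oddArea N = (if Odd (N c) then blockArea c else 0) + oddArea (N.erase c) := by
  unfold oddArea
  exact (Finsupp.add_sum_erase' N c (fun c n => if Odd n then blockArea c else 0) (by simp)).symm

lemma oddArea_request (N : BlockClass →₀ ℕ) (c : BlockClass) :
    oddArea (request N c) =
      oddArea N + (if Odd (N c) then - blockArea c else blockArea c) := by
  rw [oddArea_eq_add_erase _ c, oddArea_eq_add_erase N c, request_apply_self, request,
    Finsupp.erase_add, Finsupp.erase_single]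
  by_cases h : Odd (N c)
  · have : ¬ Odd (N c + 1) := by simpa [Nat.odd_add_one] using h
    simp [h, this]
  · have : Odd (N c + 1) := by simpa [Nat.odd_add_one] using h
    simp [h, this]; ring

lemma mul_blockArea_le_oddArea {N : BlockClass →₀ ℕ}
    (hN : ∀ c, N c ≤ 2 * N (parentClass c) + 1) (c : BlockClass) :
    N c * blockArea c ≤ oddArea N := by
  obtain ⟨K, hK⟩ := exists_iterate_parentClass_eq_zero N c
  set g : BlockClass → ℝ := fun d => if Odd (N d) then blockArea d else 0 with hg
  have hg0 : ∀ d, 0 ≤ g d := fun d => by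
    simp only [hg]; split_ifs
    · exact (blockArea_pos d).le
    · exact le_rfl
  have step : ∀ d, N d * blockArea d ≤
      g d + N (parentClass d) * blockArea (parentClass d) := by
    intro d
    have hd := hN d
    have hpos := blockArea_pos d
    rw [blockArea_parentClass]
    simp only [hg]
    split_ifs with h
    · have : (N d : ℝ) ≤ 2 * N (parentClass d) + 1 := by exact_mod_cast hd
      nlinarith
    · have : N d ≤ 2 * N (parentClass d) := by
        rw [Nat.not_odd_iff_even] at h
        obtain ⟨k, hk⟩ := h
        omega
      have : (N d : ℝ) ≤ 2 * N (parentClass d) := by exact_mod_cast this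
      nlinarith
  have tele : ∀ k : ℕ, N c * blockArea c ≤ ∑ l ∈ Finset.range k, g (parentClass^[l] c) +
      N (parentClass^[k] c) * blockArea (parentClass^[k] c) := by
    intro k
    induction k with
    | zero => simp
    | succ k ih =>
      have := step (parentClass^[k] c)
      rw [Finset.sum_range_succ, Function.iterate_succ_apply']
      linarith
  have h1 := tele K
  rw [hK, Nat.cast_zero, zero_mul, add_zero] at h1
  refine h1.trans ?_
  rw [← Finset.sum_image (f := g) (g := fun l => parentClass^[l] c)
    (fun a _ b _ h => iterate_parentClass_injective c h)]
  have h2 : oddArea N = ∑ d ∈ N.support ∪ (Finset.range K).image (fun l => parentClass^[l] c),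
      g d := by
    unfold oddArea
    exact Finsupp.sum_of_support_subset _ Finset.subset_union_left _ (by simp)
  rw [h2]
  exact Finset.sum_le_sum_of_subset_of_nonneg Finset.subset_union_right fun d _ _ => hg0 d

/-! ### The invariant of the online strategy -/

/-- There were so many requests that a block may end at the abscissa `x`. -/
def RequestedX (N : BlockClass →₀ ℕ) (x : ℝ) : Prop :=
  ∃ c : BlockClass, c.1 ≤ c.2 ∧
    ((2 ≤ N c ∧ x ≤ 3 * (blockSize c).1) ∨ (3 ≤ N c ∧ x ≤ 4 * (blockSize c).1))

/-- There were so many requests that a block may end at the ordinate `y`. -/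
def RequestedY (N : BlockClass →₀ ℕ) (y : ℝ) : Prop :=
  ∃ c : BlockClass, c.2 < c.1 ∧
    ((2 ≤ N c ∧ y ≤ 3 * (blockSize c).2) ∨ (3 ≤ N c ∧ y ≤ 4 * (blockSize c).2))

/-- The admissible positions `q` of a block of class `c`. -/
def Admissible (N : BlockClass →₀ ℕ) (c : BlockClass) (q : ℝ × ℝ) : Prop :=
  (0 ≤ q.1 ∧ 0 ≤ q.2) ∧ (q.1 = (blockSize c).1 ∨ RequestedX N (q.1 + (blockSize c).1)) ∧
    (q.2 = (blockSize c).2 ∨ RequestedY N (q.2 + (blockSize c).2))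

lemma RequestedX.mono {N M : BlockClass →₀ ℕ} (h : N ≤ M) {x y : ℝ} (hyx : y ≤ x)
    (hx : RequestedX N x) : RequestedX M y := by
  obtain ⟨c, hc, ⟨h1, h2⟩ | ⟨h1, h2⟩⟩ := hx
  · exact ⟨c, hc, Or.inl ⟨h1.trans (h c), hyx.trans h2⟩⟩
  · exact ⟨c, hc, Or.inr ⟨h1.trans (h c), hyx.trans h2⟩⟩

lemma RequestedY.mono {N M : BlockClass →₀ ℕ} (h : N ≤ M) {x y : ℝ} (hyx : y ≤ x)
    (hx : RequestedY N x) : RequestedY M y := by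
  obtain ⟨c, hc, ⟨h1, h2⟩ | ⟨h1, h2⟩⟩ := hx
  · exact ⟨c, hc, Or.inl ⟨h1.trans (h c), hyx.trans h2⟩⟩
  · exact ⟨c, hc, Or.inr ⟨h1.trans (h c), hyx.trans h2⟩⟩

lemma Admissible.mono {N M : BlockClass →₀ ℕ} (h : N ≤ M) {c : BlockClass} {q : ℝ × ℝ}
    (hq : Admissible N c q) : Admissible M c q :=
  ⟨hq.1, hq.2.1.imp_right (RequestedX.mono h le_rfl), hq.2.2.imp_right (RequestedY.mono h le_rfl)⟩

/-- `N` counts the requests for blocks of each class, a block of class `c` is available at `av c`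
if `N c` is even, and `B` lists the blocks handed out so far. -/
structure Allocation (N : BlockClass →₀ ℕ) (av : BlockClass → ℝ × ℝ)
    (B : List (BlockClass × (ℝ × ℝ))) : Prop where
  sep_av : ∀ c d, c ≠ d → Even (N c) → Even (N d) →
    Separated (blockSize c) (av c) (blockSize d) (av d)
  sep_av_mem : ∀ c, Even (N c) → ∀ b ∈ B, Separated (blockSize c) (av c) (blockSize b.1) b.2
  sep_mem : B.Pairwise fun a b => Separated (blockSize a.1) a.2 (blockSize b.1) b.2
  admissible_av : ∀ c, Even (N c) → Admissible (request N c) c (av c)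
  admissible_mem : ∀ b ∈ B, Admissible N b.1 b.2
  le_parent : ∀ c, N c ≤ 2 * N (parentClass c) + 1
  area : oddArea N = (B.map fun b => blockArea b.1).sum

lemma Allocation.nil : Allocation 0 blockSize [] where
  sep_av c d h _ _ := by
    have key : ∀ m n : ℤ, m < n → (2 : ℝ) ^ m + 2 ^ m ≤ 2 ^ n := by
      intro m n h
      calc (2 : ℝ) ^ m + 2 ^ m = 2 ^ (m + 1) := by rw [zpow_add_one₀ two_ne_zero]; ring
        _ ≤ 2 ^ n := zpow_le_zpow_right₀ one_le_two h
    simp only [Separated, blockSize]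
    rcases lt_trichotomy c.1 d.1 with h1 | h1 | h1
    · exact Or.inl (key _ _ h1)
    · rcases lt_trichotomy c.2 d.2 with h2 | h2 | h2
      · exact Or.inr (Or.inr (Or.inl (by linarith [key _ _ h2])))
      · exact absurd (Prod.ext h1 h2) h
      · exact Or.inr (Or.inr (Or.inr (by linarith [key _ _ h2])))
    · exact Or.inr (Or.inl (key _ _ h1))
  sep_av_mem := by simp
  sep_mem := List.Pairwise.nil
  admissible_av c _ := ⟨⟨(blockSize_fst_pos c).le, (blockSize_snd_pos c).le⟩, Or.inl rfl, Or.inl rfl⟩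
  admissible_mem := by simp
  le_parent := by simp
  area := by simp [oddArea]

lemma parentClass_ne (c : BlockClass) : parentClass c ≠ c := by
  intro h
  have := parentClass_fst_add_snd c
  rw [h] at this
  omega

lemma Allocation.take {N : BlockClass →₀ ℕ} {av : BlockClass → ℝ × ℝ}
    {B : List (BlockClass × (ℝ × ℝ))} (h : Allocation N av B) {c : BlockClass}
    (hc : Even (N c)) : Allocation (request N c) av ((c, av c) :: B) := by
  have hodd : ¬ Even ((request N c) c) := by
    rw [request_apply_self, Nat.even_add_one]; exact not_not.2 hc
  have hne : ∀ d, Even ((request N c) d) → d ≠ c ∧ Even (N d) := by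
    intro d hd
    have : d ≠ c := by rintro rfl; exact hodd hd
    exact ⟨this, by rwa [request_apply_of_ne N this] at hd⟩
  refine ⟨?_, ?_, ?_, ?_, ?_, ?_, ?_⟩
  · intro d e hde hd he
    exact h.sep_av d e hde (hne d hd).2 (hne e he).2
  · intro d hd b hb
    rcases List.mem_cons.1 hb with rfl | hb
    · exact h.sep_av d c (hne d hd).1 (hne d hd).2 hc
    · exact h.sep_av_mem d (hne d hd).2 b hb
  · exact List.pairwise_cons.2 ⟨h.sep_av_mem c hc, h.sep_mem⟩
  · intro d hd
    exact (h.admissible_av d (hne d hd).2).mono (request_mono (le_request N c) d)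
  · intro b hb
    rcases List.mem_cons.1 hb with rfl | hb
    · exact h.admissible_av c hc
    · exact (h.admissible_mem b hb).mono (le_request N c)
  · intro d
    have hd := h.le_parent d
    have hle := le_request N c (parentClass d)
    by_cases hdc : d = c
    · subst hdc
      rw [request_apply_self]
      obtain ⟨k, hk⟩ := hc
      omega
    · rw [request_apply_of_ne N hdc]; omega
  · rw [oddArea_request, if_neg (by rwa [Nat.not_odd_iff_even]), h.area]
    simp [add_comm]

lemma Allocation.split {N : BlockClass →₀ ℕ} {av : BlockClass → ℝ × ℝ}
    {B : List (BlockClass × (ℝ × ℝ))} {c : BlockClass} {q : ℝ × ℝ}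
    (h : Allocation N av ((parentClass c, q) :: B)) (hc : Odd (N c))
    (hle : N c ≤ 2 * N (parentClass c)) :
    ∃ r, Allocation (request N c) (Function.update av c r) ((c, q) :: B) := by
  have hw := blockSize_fst_pos c
  have hh := blockSize_snd_pos c
  have hpos : 1 ≤ N c := hc.pos
  obtain ⟨⟨hq1, hq2⟩, hqx, hqy⟩ := h.admissible_mem _ (List.mem_cons_self ..)
  obtain ⟨r, hr1, hr2, hr1', hr2', hsep, hadq, hadr⟩ : ∃ r : ℝ × ℝ, q.1 ≤ r.1 ∧ q.2 ≤ r.2 ∧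
      r.1 + (blockSize c).1 ≤ q.1 + (blockSize (parentClass c)).1 ∧
      r.2 + (blockSize c).2 ≤ q.2 + (blockSize (parentClass c)).2 ∧
      Separated (blockSize c) r (blockSize c) q ∧ Admissible (request N c) c q ∧
      Admissible (request (request N c) c) c r := by
    have mono1 := le_request N c
    have mono2 := mono1.trans (le_request (request N c) c)
    rcases le_or_gt c.1 c.2 with hcc | hcc
    · simp only [blockSize_parentClass_of_le hcc] at hqx hqy ⊢
      refine ⟨(q.1 + (blockSize c).1, q.2), by simp [hw.le], le_rfl, by simp; linarith, by simp,
        Or.inr (Or.inl le_rfl), ⟨⟨hq1, hq2⟩, Or.inr ?_, hqy.imp_right (.mono mono1 le_rfl)⟩,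
        ⟨⟨by simp; linarith, hq2⟩, Or.inr ?_, hqy.imp_right (.mono mono2 le_rfl)⟩⟩
      · rcases hqx with hqx | hqx
        · refine ⟨c, hcc, Or.inl ⟨?_, by linarith⟩⟩
          rw [request_apply_self]; omega
        · exact hqx.mono mono1 (by linarith)
      · rcases hqx with hqx | hqx
        · refine ⟨c, hcc, Or.inr ⟨?_, by simp; linarith⟩⟩
          rw [request_apply_self, request_apply_self]; omega
        · exact hqx.mono mono2 (by simp; linarith)
    · simp only [blockSize_parentClass_of_lt hcc] at hqx hqy ⊢
      refine ⟨(q.1, q.2 + (blockSize c).2), le_rfl, by simp [hh.le], by simp, by simp; linarith,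
        Or.inr (Or.inr (Or.inr le_rfl)),
        ⟨⟨hq1, hq2⟩, hqx.imp_right (.mono mono1 le_rfl), Or.inr ?_⟩,
        ⟨⟨hq1, by simp; linarith⟩, hqx.imp_right (.mono mono2 le_rfl), Or.inr ?_⟩⟩
      · rcases hqy with hqy | hqy
        · refine ⟨c, hcc, Or.inl ⟨?_, by linarith⟩⟩
          rw [request_apply_self]; omega
        · exact hqy.mono mono1 (by linarith)
      · rcases hqy with hqy | hqy
        · refine ⟨c, hcc, Or.inr ⟨?_, by simp; linarith⟩⟩
          rw [request_apply_self, request_apply_self]; omega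
        · exact hqy.mono mono2 (by simp; linarith)
  have hpq1 : (blockSize c).1 ≤ (blockSize (parentClass c)).1 := by linarith
  have hpq2 : (blockSize c).2 ≤ (blockSize (parentClass c)).2 := by linarith
  have hsub : ∀ t s, Separated (blockSize (parentClass c)) q t s →
      Separated (blockSize c) r t s ∧ Separated (blockSize c) q t s := fun t s hs =>
    ⟨hs.mono_left hr1 hr2 hr1' hr2', hs.mono_left le_rfl le_rfl (by linarith) (by linarith)⟩
  have hmem := List.pairwise_cons.1 h.sep_mem
  have heven : ∀ d, d ≠ c → Even (request N c d) → Even (N d) := by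
    intro d hd hed
    rwa [request_apply_of_ne N hd] at hed
  refine ⟨r, ?_, ?_, ?_, ?_, ?_, ?_, ?_⟩
  · intro d e hde hd he
    by_cases hdc : d = c
    · subst hdc
      rw [Function.update_self, Function.update_of_ne hde.symm]
      exact (hsub _ _ (h.sep_av_mem e (heven e hde.symm he) _ (List.mem_cons_self ..)).symm).1
    · rw [Function.update_of_ne hdc]
      by_cases hec : e = c
      · subst hec
        rw [Function.update_self]
        exact (hsub _ _ (h.sep_av_mem d (heven d hdc hd) _ (List.mem_cons_self ..)).symm).1.symm
      · rw [Function.update_of_ne hec]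
        exact h.sep_av d e hde (heven d hdc hd) (heven e hec he)
  · intro d hd b hb
    by_cases hdc : d = c
    · subst hdc
      rw [Function.update_self]
      rcases List.mem_cons.1 hb with rfl | hb
      · exact hsep
      · exact (hsub _ _ (hmem.1 b hb)).1
    · rw [Function.update_of_ne hdc]
      rcases List.mem_cons.1 hb with rfl | hb
      · exact (hsub _ _ (h.sep_av_mem d (heven d hdc hd) _ (List.mem_cons_self ..)).symm).2.symm
      · exact h.sep_av_mem d (heven d hdc hd) b (List.mem_cons_of_mem _ hb)
  · exact List.pairwise_cons.2 ⟨fun b hb => (hsub _ _ (hmem.1 b hb)).2, hmem.2⟩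
  · intro d hd
    by_cases hdc : d = c
    · subst hdc
      rwa [Function.update_self]
    · rw [Function.update_of_ne hdc]
      exact (h.admissible_av d (heven d hdc hd)).mono (request_mono (le_request N c) d)
  · intro b hb
    rcases List.mem_cons.1 hb with rfl | hb
    · exact hadq
    · exact (h.admissible_mem b (List.mem_cons_of_mem _ hb)).mono (le_request N c)
  · intro d
    have hd := h.le_parent d
    have hge := le_request N c (parentClass d)
    by_cases hdc : d = c
    · subst hdc
      rw [request_apply_self]; omega
    · rw [request_apply_of_ne N hdc]; omega
  · rw [oddArea_request, if_pos hc, h.area]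
    simp [blockArea_parentClass]; ring

lemma Allocation.exists_cons (k : ℕ) : ∀ {N : BlockClass →₀ ℕ} {av : BlockClass → ℝ × ℝ}
    {B : List (BlockClass × (ℝ × ℝ))} (_ : Allocation N av B) (c : BlockClass)
    (_ : Even (N (parentClass^[k] c))), ∃ M av' q, Allocation M av' ((c, q) :: B) ∧
      M c = N c + 1 ∧ ∀ d : BlockClass, d.1 + d.2 < c.1 + c.2 → M d = N d := by
  have base : ∀ {N : BlockClass →₀ ℕ} {av : BlockClass → ℝ × ℝ}
      {B : List (BlockClass × (ℝ × ℝ))} (_ : Allocation N av B) (c : BlockClass)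
      (_ : Even (N c)), ∃ M av' q, Allocation M av' ((c, q) :: B) ∧
        M c = N c + 1 ∧ ∀ d : BlockClass, d.1 + d.2 < c.1 + c.2 → M d = N d := by
    intro N av B h c hc
    refine ⟨_, _, _, h.take hc, request_apply_self N c, fun d hd => request_apply_of_ne N ?_⟩
    rintro rfl
    exact lt_irrefl _ hd
  induction k with
  | zero => exact base
  | succ k ih =>
    intro N av B h c hk
    by_cases hc : Even (N c)
    · exact base h c hc
    obtain ⟨M, av', q, hM, hMp, hMd⟩ := ih h (parentClass c) hk
    have hsum := parentClass_fst_add_snd c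
    have hMc : M c = N c := hMd c (by omega)
    rw [Nat.not_even_iff_odd] at hc
    have hle := h.le_parent c
    obtain ⟨r, hr⟩ := hM.split (by rwa [hMc]) (by omega)
    refine ⟨_, _, _, hr, by rw [request_apply_self, hMc], fun d hd => ?_⟩
    rw [request_apply_of_ne M, hMd d (by omega)]
    rintro rfl
    exact lt_irrefl _ hd

/-- The pieces of `l`, given with their positions, lie in blocks that were allocated for them. -/
def Maintained (l : List (Piece × (ℝ × ℝ))) : Prop :=
  ∃ N av, Allocation N av (l.map fun x => (pieceClass x.1, x.2))

lemma Maintained.nil : Maintained [] := ⟨_, _, Allocation.nil⟩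

lemma Maintained.exists_cons {l : List (Piece × (ℝ × ℝ))} (h : Maintained l) (p : Piece) :
    ∃ q, Maintained ((p, q) :: l) := by
  obtain ⟨N, av, h⟩ := h
  obtain ⟨k, hk⟩ := exists_iterate_parentClass_eq_zero N (pieceClass p)
  obtain ⟨M, av', q, hM, -⟩ := h.exists_cons k (pieceClass p) (by simp [hk])
  exact ⟨q, M, av', hM⟩

lemma pieceClass_bounds {p : Piece} (hp : PiecePos p) :
    (p.1 ≤ (blockSize (pieceClass p)).1 ∧ (blockSize (pieceClass p)).1 ≤ 2 * p.1) ∧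
      p.2 ≤ (blockSize (pieceClass p)).2 ∧ (blockSize (pieceClass p)).2 ≤ 2 * p.2 := by
  have key : ∀ x : ℝ, 0 < x → x ≤ 2 ^ Int.clog 2 x ∧ (2 : ℝ) ^ Int.clog 2 x ≤ 2 * x := by
    intro x hx
    have h1 := Int.self_le_zpow_clog one_lt_two x
    have h2 := Int.zpow_pred_clog_lt_self one_lt_two hx
    rw [Nat.cast_ofNat] at h1 h2
    rw [zpow_sub_one₀ two_ne_zero] at h2
    exact ⟨h1, by linarith⟩
  have h1 := key p.1 hp.1
  have h2 := key (p.2 / (7 / 5)) (div_pos hp.2 (by norm_num))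
  refine ⟨h1, ?_, ?_⟩
  · simp only [blockSize, pieceClass]; linarith [h2.1]
  · simp only [blockSize, pieceClass]; linarith [h2.2]

lemma Maintained.separated {l : List (Piece × (ℝ × ℝ))} (h : Maintained l)
    (hl : ∀ x ∈ l, PiecePos x.1) : l.Pairwise fun x y => Separated x.1 x.2 y.1 y.2 := by
  obtain ⟨N, av, h⟩ := h
  refine (List.pairwise_map.1 h.sep_mem).imp_of_mem fun {x y} hx hy hxy => ?_
  have bx := pieceClass_bounds (hl x hx)
  have cy := pieceClass_bounds (hl y hy)
  have h1 := hxy.mono_left (s' := x.1) le_rfl le_rfl (by simpa using bx.1.1)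
    (by simpa using bx.2.1)
  exact (h1.symm.mono_left (s' := y.1) le_rfl le_rfl (by simpa using cy.1.1)
    (by simpa using cy.2.1)).symm

lemma Allocation.mul_blockArea_le {N : BlockClass →₀ ℕ} {av : BlockClass → ℝ × ℝ}
    {l : List (Piece × (ℝ × ℝ))} (h : Allocation N av (l.map fun x => (pieceClass x.1, x.2)))
    (hl : ∀ x ∈ l, PiecePos x.1) (c : BlockClass) :
    N c * blockArea c ≤ 4 * (l.map fun x => x.1.1 * x.1.2).sum := by
  refine (mul_blockArea_le_oddArea h.le_parent c).trans ?_
  rw [h.area, List.map_map, ← List.sum_map_mul_left]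
  refine List.sum_le_sum fun x hx => ?_
  have bx := pieceClass_bounds (hl x hx)
  have := mul_le_mul bx.1.2 bx.2.2 (blockSize_snd_pos _).le (by linarith [(hl x hx).1])
  simp only [Function.comp_apply, blockArea]
  linarith

lemma mul_fst_sq_le_blockArea {c : BlockClass} (h : c.1 ≤ c.2) :
    7 / 5 * (blockSize c).1 ^ 2 ≤ blockArea c := by
  have h1 : (2 : ℝ) ^ c.1 ≤ 2 ^ c.2 := zpow_le_zpow_right₀ one_le_two h
  have h2 := blockSize_fst_pos c
  simp only [blockArea, blockSize] at *
  nlinarith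

lemma mul_snd_sq_le_blockArea {c : BlockClass} (h : c.2 < c.1) :
    10 / 7 * (blockSize c).2 ^ 2 ≤ blockArea c := by
  have h1 : (2 : ℝ) ^ (c.2 + 1) ≤ 2 ^ c.1 := zpow_le_zpow_right₀ one_le_two h
  rw [zpow_add_one₀ two_ne_zero] at h1
  have h2 := blockSize_snd_pos c
  simp only [blockArea, blockSize] at *
  nlinarith

lemma Maintained.extent {l : List (Piece × (ℝ × ℝ))} (h : Maintained l)
    (hl : ∀ x ∈ l, PiecePos x.1) : ∀ x ∈ l, (0 ≤ x.2.1 ∧ 0 ≤ x.2.2) ∧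
      (x.2.1 + x.1.1 ≤ 3 * x.1.1 ∨
        (x.2.1 + x.1.1) ^ 2 ≤ 15.3 * (l.map fun x => x.1.1 * x.1.2).sum) ∧
      (x.2.2 + x.1.2 ≤ 3 * x.1.2 ∨
        (x.2.2 + x.1.2) ^ 2 ≤ 15.3 * (l.map fun x => x.1.1 * x.1.2).sum) := by
  obtain ⟨N, av, h⟩ := h
  intro x hx
  obtain ⟨h0, hX, hY⟩ := h.admissible_mem _ (List.mem_map_of_mem hx)
  have bx := pieceClass_bounds (hl x hx)
  have hxp := hl x hx
  have hcount : ∀ (c : BlockClass) (m : ℕ), m ≤ N c →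
      m * blockArea c ≤ 4 * (l.map fun x => x.1.1 * x.1.2).sum := fun c m hm =>
    (mul_le_mul_of_nonneg_right (by exact_mod_cast hm) (blockArea_pos c).le).trans
      (h.mul_blockArea_le hl c)
  refine ⟨h0, ?_, ?_⟩
  · rcases hX with hX | ⟨c, hc, hX⟩
    · left; simp only at hX; linarith
    · right
      have ha := mul_fst_sq_le_blockArea hc
      have hp := blockSize_fst_pos c
      have hr : 0 ≤ x.2.1 + x.1.1 := by linarith [h0.1, hxp.1]
      rcases hX with ⟨h1, h2⟩ | ⟨h1, h2⟩
      · have h3 := pow_le_pow_left₀ hr ((add_le_add_right bx.1.1 _).trans h2) 2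
        have h4 := hcount c 2 h1
        push_cast at h4
        nlinarith
      · have h3 := pow_le_pow_left₀ hr ((add_le_add_right bx.1.1 _).trans h2) 2
        have h4 := hcount c 3 h1
        push_cast at h4
        nlinarith
  · rcases hY with hY | ⟨c, hc, hY⟩
    · left; simp only at hY; linarith
    · right
      have ha := mul_snd_sq_le_blockArea hc
      have hp := blockSize_snd_pos c
      have hr : 0 ≤ x.2.2 + x.1.2 := by linarith [h0.2, hxp.2]
      rcases hY with ⟨h1, h2⟩ | ⟨h1, h2⟩
      · have h3 := pow_le_pow_left₀ hr ((add_le_add_right bx.2.1 _).trans h2) 2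
        have h4 := hcount c 2 h1
        push_cast at h4
        nlinarith
      · have h3 := pow_le_pow_left₀ hr ((add_le_add_right bx.2.1 _).trans h2) 2
        have h4 := hcount c 3 h1
        push_cast at h4
        nlinarith

/-! ### Online strategies from invariants -/

open Classical in
/-- Extends a list of placed pieces by the piece `p`, maintaining `I` if possible. -/
noncomputable def extendPlacement (I : List (Piece × (ℝ × ℝ)) → Prop)
    (l : List (Piece × (ℝ × ℝ))) (p : Piece) : List (Piece × (ℝ × ℝ)) :=
  (p, if h : ∃ q, I ((p, q) :: l) then h.choose else 0) :: l

/-- An invariant that can be maintained whenever a piece arrives is maintained by some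
online strategy. -/
lemma exists_strategy_of_invariant {I : List (Piece × (ℝ × ℝ)) → Prop} (h0 : I [])
    (hI : ∀ l, I l → ∀ p, ∃ q, I ((p, q) :: l)) :
    ∃ σ : List Piece → ℝ × ℝ, ∀ L : List Piece,
      I (List.ofFn fun i : Fin L.length => (L.get i, onlinePos σ L i)).reverse := by
  set F : List Piece → List (Piece × (ℝ × ℝ)) := fun L => L.foldl (extendPlacement I) [] with hF
  set σ : List Piece → ℝ × ℝ := fun L => (F L).head?.elim 0 Prod.snd with hσ
  have F_append : ∀ L p, F (L ++ [p]) = extendPlacement I (F L) p := by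
    intro L p; simp [hF]
  have F_inv : ∀ L, I (F L) := by
    intro L
    induction L using List.reverseRecOn with
    | nil => exact h0
    | append_singleton L p ih =>
      have hex := hI _ ih p
      rw [F_append, extendPlacement, dif_pos hex]
      exact hex.choose_spec
  have F_eq : ∀ L : List Piece,
      F L = (List.ofFn fun i : Fin L.length => (L.get i, onlinePos σ L i)).reverse := by
    intro L
    induction L using List.reverseRecOn with
    | nil => simp [hF]
    | append_singleton L p ih =>
      have hlast : (p, σ (L ++ [p])) :: F L = F (L ++ [p]) := by
        simp only [hσ, F_append, extendPlacement, List.head?_cons, Option.elim_some]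
      rw [← hlast, ih, ← List.reverse_concat]
      congr 1
      apply List.ext_getElem
      · simp
      · intro i h1 h2
        simp only [List.length_append, List.length_ofFn, List.length_cons, List.length_nil] at h1
        rcases Nat.lt_succ_iff_lt_or_eq.1 h1 with hi | rfl
        · rw [List.getElem_append_left (by simpa using hi), List.getElem_ofFn, List.getElem_ofFn]
          simp [hi, onlinePos, List.take_append_of_le_length (Nat.succ_le_of_lt hi)]
        · rw [List.getElem_append_right (by simp), List.getElem_ofFn]
          simp [onlinePos, List.take_of_length_le]
  exact ⟨σ, fun L => F_eq L ▸ F_inv L⟩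

/-! ### Bounding boxes of packings -/

lemma interior_placedRect (p : Piece) (q : ℝ × ℝ) :
    interior (placedRect p q) = Ioo q.1 (q.1 + p.1) ×ˢ Ioo q.2 (q.2 + p.2) := by
  rw [placedRect, interior_prod_eq, interior_Icc, interior_Icc]

lemma Separated.disjoint_interior {p p' : Piece} {q q' : ℝ × ℝ} (h : Separated p q p' q') :
    Disjoint (interior (placedRect p q)) (interior (placedRect p' q')) := by
  rw [interior_placedRect, interior_placedRect, Set.disjoint_left]
  rintro x ⟨⟨h1, h2⟩, h3, h4⟩ ⟨⟨h5, h6⟩, h7, h8⟩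
  rcases h with h | h | h | h <;> linarith

lemma isCompact_packedSet (L : List Piece) (pos : Fin L.length → ℝ × ℝ) :
    IsCompact (packedSet L pos) :=
  isCompact_iUnion fun _ => isCompact_Icc.prod isCompact_Icc

lemma packedSet_subset_box (L : List Piece) (pos : Fin L.length → ℝ × ℝ) :
    packedSet L pos ⊆
      Icc (sInf (Prod.fst '' packedSet L pos)) (sSup (Prod.fst '' packedSet L pos)) ×ˢ
      Icc (sInf (Prod.snd '' packedSet L pos)) (sSup (Prod.snd '' packedSet L pos)) := by
  have hc := isCompact_packedSet L pos
  intro x hx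
  exact ⟨⟨csInf_le (hc.image continuous_fst).bddBelow (mem_image_of_mem _ hx),
      le_csSup (hc.image continuous_fst).bddAbove (mem_image_of_mem _ hx)⟩,
    csInf_le (hc.image continuous_snd).bddBelow (mem_image_of_mem _ hx),
    le_csSup (hc.image continuous_snd).bddAbove (mem_image_of_mem _ hx)⟩

lemma le_boxWidth_and_boxHeight {L : List Piece} (hL : ∀ p ∈ L, PiecePos p)
    (pos : Fin L.length → ℝ × ℝ) (i : Fin L.length) :
    (L.get i).1 ≤ boxWidth (packedSet L pos) ∧ (L.get i).2 ≤ boxHeight (packedSet L pos) := by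
  have hp := hL _ (L.get_mem i)
  have hsub : placedRect (L.get i) (pos i) ⊆ packedSet L pos :=
    subset_iUnion (fun i => placedRect (L.get i) (pos i)) i
  have h1 := packedSet_subset_box L pos (hsub
    (show pos i ∈ _ from ⟨⟨le_rfl, by linarith [hp.1]⟩, le_rfl, by linarith [hp.2]⟩))
  have h2 := packedSet_subset_box L pos (hsub
    (show ((pos i).1 + (L.get i).1, (pos i).2 + (L.get i).2) ∈ _ from
      ⟨⟨by linarith [hp.1], le_rfl⟩, by linarith [hp.2], le_rfl⟩))
  have h3 := h1.1.1
  have h4 := h1.2.1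
  have h5 := h2.1.2
  have h6 := h2.2.2
  simp only at h5 h6
  unfold boxWidth boxHeight
  exact ⟨by linarith, by linarith⟩

open MeasureTheory in
lemma sum_area_le_boxWidth_mul_boxHeight {L : List Piece} (hne : L ≠ [])
    (hL : ∀ p ∈ L, PiecePos p) {pos : Fin L.length → ℝ × ℝ} (h : IsPacking L pos) :
    ∑ i : Fin L.length, (L.get i).1 * (L.get i).2 ≤
      boxWidth (packedSet L pos) * boxHeight (packedSet L pos) := by
  have hb := le_boxWidth_and_boxHeight hL pos ⟨0, List.length_pos_iff.2 hne⟩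
  have hp := hL _ (L.get_mem ⟨0, List.length_pos_iff.2 hne⟩)
  have hw : 0 ≤ boxWidth (packedSet L pos) := hp.1.le.trans hb.1
  have hh : 0 ≤ boxHeight (packedSet L pos) := hp.2.le.trans hb.2
  have hvol : ∀ i, volume (interior (placedRect (L.get i) (pos i))) =
      ENNReal.ofReal ((L.get i).1 * (L.get i).2) := by
    intro i
    rw [interior_placedRect, Measure.volume_eq_prod, Measure.prod_prod, Real.volume_Ioo,
      Real.volume_Ioo, add_sub_cancel_left, add_sub_cancel_left,
      ENNReal.ofReal_mul (hL _ (L.get_mem i)).1.le]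
  have hsub : (⋃ i : Fin L.length, interior (placedRect (L.get i) (pos i))) ⊆ packedSet L pos :=
    iUnion_mono fun _ => interior_subset
  have hle := measure_mono (μ := volume) (hsub.trans (packedSet_subset_box L pos))
  rw [measure_iUnion (fun i j hij => h i j hij) (fun i => isOpen_interior.measurableSet),
    tsum_fintype, Finset.sum_congr rfl fun i _ => hvol i, Measure.volume_eq_prod,
    Measure.prod_prod, Real.volume_Icc, Real.volume_Icc, ← boxWidth, ← boxHeight,
    ← ENNReal.ofReal_mul hw,
    ← ENNReal.ofReal_sum_of_nonneg fun i _ =>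
      mul_nonneg (hL _ (L.get_mem i)).1.le (hL _ (L.get_mem i)).2.le] at hle
  exact (ENNReal.ofReal_le_ofReal_iff (mul_nonneg hw hh)).1 hle

lemma periCost_le {L : List Piece} (hne : L ≠ []) (hL : ∀ p ∈ L, PiecePos p)
    {pos : Fin L.length → ℝ × ℝ} {X Y : ℝ} (h0 : ∀ i, 0 ≤ (pos i).1 ∧ 0 ≤ (pos i).2)
    (hX : ∀ i, (pos i).1 + (L.get i).1 ≤ X) (hY : ∀ i, (pos i).2 + (L.get i).2 ≤ Y) :
    periCost L pos ≤ 2 * (X + Y) := by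
  have hnonempty : (packedSet L pos).Nonempty := by
    have i : Fin L.length := ⟨0, List.length_pos_iff.2 hne⟩
    have hp := hL _ (L.get_mem i)
    exact ⟨pos i, mem_iUnion.2
      ⟨i, ⟨le_rfl, by linarith [hp.1]⟩, le_rfl, by linarith [hp.2]⟩⟩
  have hmem : ∀ x ∈ packedSet L pos, (0 ≤ x.1 ∧ x.1 ≤ X) ∧ 0 ≤ x.2 ∧ x.2 ≤ Y := by
    intro x hx
    obtain ⟨i, ⟨h1, h2⟩, h3, h4⟩ := mem_iUnion.1 hx
    exact ⟨⟨(h0 i).1.trans h1, h2.trans (hX i)⟩, (h0 i).2.trans h3, h4.trans (hY i)⟩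
  have h1 : sSup (Prod.fst '' packedSet L pos) ≤ X :=
    csSup_le (hnonempty.image _) (forall_mem_image.2 fun x hx => (hmem x hx).1.2)
  have h2 : 0 ≤ sInf (Prod.fst '' packedSet L pos) :=
    le_csInf (hnonempty.image _) (forall_mem_image.2 fun x hx => (hmem x hx).1.1)
  have h3 : sSup (Prod.snd '' packedSet L pos) ≤ Y :=
    csSup_le (hnonempty.image _) (forall_mem_image.2 fun x hx => (hmem x hx).2.2)
  have h4 : 0 ≤ sInf (Prod.snd '' packedSet L pos) :=
    le_csInf (hnonempty.image _) (forall_mem_image.2 fun x hx => (hmem x hx).2.1)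
  unfold periCost boxWidth boxHeight
  linarith

lemma max_add_max_le {a b s : ℝ} (ha : 0 ≤ a) (hb : 0 ≤ b)
    (h : s ^ 2 ≤ 15.3 * (a * b)) : max (3 * a) s + max (3 * b) s ≤ 3.99 * (a + b) := by
  have h1 : s ≤ 3.99 / 2 * (a + b) :=
    abs_le_of_sq_le_sq' (by nlinarith [sq_nonneg (a - b), mul_nonneg ha hb]) (by positivity) |>.2
  have key : ∀ x y : ℝ, 0 ≤ x → 0 ≤ y → s ^ 2 ≤ 15.3 * (x * y) → s ≤ 0.99 * x + 3.99 * y := by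
    intro x y hx hy hxy
    exact abs_le_of_sq_le_sq' (by nlinarith [sq_nonneg (0.99 * x - 3.99 * y), mul_nonneg hx hy])
      (by positivity) |>.2
  have h2 := key a b ha hb h
  have h3 := key b a hb ha (by linarith)
  rcases max_cases (3 * a) s with ⟨e1, -⟩ | ⟨e1, -⟩ <;>
  rcases max_cases (3 * b) s with ⟨e2, -⟩ | ⟨e2, -⟩ <;> rw [e1, e2] <;> linarith

/-- There exist a real constant `c < 4` and a valid online
translation strategy `σ` such that for every nonempty finite stream `L` of
pieces, `ALG_σ(L) ≤ c * OPT(L)` (perimeter of the bounding box). -/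
theorem perimeter_translation_upper_bound :
    ∃ c : ℝ, c < 4 ∧ ∃ σ : List Piece → ℝ × ℝ, StrategyValid σ ∧
      ∀ L : List Piece, L ≠ [] → (∀ p ∈ L, PiecePos p) →
        algPeri σ L ≤ c * optPeri L := by
  obtain ⟨σ, hσ⟩ := exists_strategy_of_invariant Maintained.nil
    fun l hl p => Maintained.exists_cons hl p
  have hpos : ∀ L : List Piece, (∀ p ∈ L, PiecePos p) →
      ∀ x ∈ (List.ofFn fun i : Fin L.length => (L.get i, onlinePos σ L i)).reverse,
        PiecePos x.1 := by
    intro L hL x hx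
    obtain ⟨i, rfl⟩ := (List.mem_ofFn' _ _).1 (List.mem_reverse.1 hx)
    exact hL _ (L.get_mem i)
  have hvalid : StrategyValid σ := by
    intro L hL i j hij
    have hsep := (hσ L).separated (hpos L hL)
    rw [List.pairwise_reverse, List.pairwise_ofFn] at hsep
    rcases lt_or_gt_of_ne hij with hlt | hlt
    · exact (hsep hlt).symm.disjoint_interior
    · exact (hsep hlt).disjoint_interior
  refine ⟨3.99, by norm_num, σ, hvalid, fun L hne hL => ?_⟩
  rw [← div_le_iff₀' (by norm_num)]
  refine le_csInf ⟨_, onlinePos σ L, hvalid L hL, rfl⟩ ?_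
  rintro _ ⟨pos, hpack, rfl⟩
  rw [div_le_iff₀' (by norm_num)]
  have hext := (hσ L).extent (hpos L hL)
  have hsum : ((List.ofFn fun i : Fin L.length => (L.get i, onlinePos σ L i)).reverse.map
      fun x => x.1.1 * x.1.2).sum = ∑ i : Fin L.length, (L.get i).1 * (L.get i).2 := by
    rw [List.map_reverse, List.sum_reverse, List.map_ofFn, List.sum_ofFn]
    rfl
  rw [hsum] at hext
  have hext' : ∀ i : Fin L.length, _ := fun i =>
    hext (L.get i, onlinePos σ L i) (List.mem_reverse.2 ((List.mem_ofFn' _ _).2 ⟨i, rfl⟩))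
  have hbox := le_boxWidth_and_boxHeight hL pos
  have harea := sum_area_le_boxWidth_mul_boxHeight hne hL hpack
  have hp := hL _ (L.get_mem ⟨0, List.length_pos_iff.2 hne⟩)
  have hb := hbox ⟨0, List.length_pos_iff.2 hne⟩
  set S := ∑ i : Fin L.length, (L.get i).1 * (L.get i).2
  have hS : 0 ≤ S := Finset.sum_nonneg fun i _ =>
    mul_nonneg (hL _ (L.get_mem i)).1.le (hL _ (L.get_mem i)).2.le
  have hmax := max_add_max_le (hp.1.le.trans hb.1) (hp.2.le.trans hb.2)
    (s := √(15.3 * S)) (by rw [Real.sq_sqrt (by positivity)]; linarith)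
  have hcost := periCost_le hne hL (pos := onlinePos σ L)
    (X := max (3 * boxWidth (packedSet L pos)) √(15.3 * S))
    (Y := max (3 * boxHeight (packedSet L pos)) √(15.3 * S))
    (fun i => (hext' i).1)
    (fun i => le_max_iff.2 ((hext' i).2.1.imp
      (fun h => h.trans (by linarith [(hbox i).1])) Real.le_sqrt_of_sq_le))
    (fun i => le_max_iff.2 ((hext' i).2.2.imp
      (fun h => h.trans (by linarith [(hbox i).2])) Real.le_sqrt_of_sq_le))
  calc algPeri σ L ≤ _ := hcost
    _ ≤ 3.99 * periCost L pos := by unfold periCost; linarith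
end

section
/- There exist a real constant c < 4 and a valid online rotation strategy σ such that for every nonempty finite stream L of pieces, ALG_σ(L) ≤ c·OPT(L). (Competitive ratio strictly less than 4 for online perimeter minimization when rotations by 90° are allowed.) -/
open Set

/-! ### Rectangles and dyadic blocks -/

namespace OnlinePacking

/-- The rectangle `[x, x + w] × [y, y + h]`. -/
structure Rct where
  x : ℝ
  y : ℝ
  w : ℝ
  h : ℝ

namespace Rct

/-- Containment of rectangles. -/
def Le (r s : Rct) : Prop :=
  s.x ≤ r.x ∧ r.x + r.w ≤ s.x + s.w ∧ s.y ≤ r.y ∧ r.y + r.h ≤ s.y + s.h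

/-- Two rectangles are separated by a vertical or a horizontal line. -/
def Sep (r s : Rct) : Prop :=
  r.x + r.w ≤ s.x ∨ s.x + s.w ≤ r.x ∨ r.y + r.h ≤ s.y ∨ s.y + s.h ≤ r.y

lemma Le.refl (r : Rct) : r.Le r := ⟨le_rfl, le_rfl, le_rfl, le_rfl⟩

lemma Le.trans {r s t : Rct} (h : r.Le s) (h' : s.Le t) : r.Le t :=
  ⟨h'.1.trans h.1, h.2.1.trans h'.2.1, h'.2.2.1.trans h.2.2.1, h.2.2.2.trans h'.2.2.2⟩

lemma Sep.symm {r s : Rct} (h : r.Sep s) : s.Sep r := by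
  unfold Sep at *; tauto

lemma Sep.mono {r r' s s' : Rct} (h : r'.Sep s') (hr : r.Le r') (hs : s.Le s') : r.Sep s := by
  obtain ⟨h1, h2, h3, h4⟩ := hr
  obtain ⟨k1, k2, k3, k4⟩ := hs
  rcases h with h | h | h | h
  · exact Or.inl (by linarith)
  · exact Or.inr (Or.inl (by linarith))
  · exact Or.inr (Or.inr (Or.inl (by linarith)))
  · exact Or.inr (Or.inr (Or.inr (by linarith)))

end Rct

lemma two_zpow_pos (m : ℤ) : (0 : ℝ) < 2 ^ m := zpow_pos two_pos m

lemma two_zpow_succ (m : ℤ) : (2 : ℝ) ^ (m + 1) = 2 * 2 ^ m := by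
  rw [zpow_add_one₀ two_ne_zero, mul_comm]

lemma two_zpow_pred (m : ℤ) : (2 : ℝ) ^ (m - 1) = 2 ^ m / 2 := by
  rw [zpow_sub_one₀ two_ne_zero, div_eq_mul_inv]

lemma two_zpow_le {m n : ℤ} (h : m ≤ n) : (2 : ℝ) ^ m ≤ 2 ^ n :=
  zpow_le_zpow_right₀ one_le_two h

lemma two_zpow_two_mul (m : ℤ) : (2 : ℝ) ^ (2 * m) = 2 ^ m * 2 ^ m := by
  rw [two_mul, zpow_add₀ two_ne_zero]

/-- Width of a block of level `s`. -/
noncomputable def levelWidth (s : ℤ) : ℝ := 2 ^ ((s + 1) / 2)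

/-- Height of a block of level `s`. -/
noncomputable def levelHeight (s : ℤ) : ℝ := 2 ^ (s / 2)

lemma levelWidth_even (k : ℤ) : levelWidth (2 * k) = 2 ^ k := by
  rw [levelWidth, show (2 * k + 1) / 2 = k by omega]

lemma levelWidth_odd (k : ℤ) : levelWidth (2 * k + 1) = 2 * 2 ^ k := by
  rw [levelWidth, show (2 * k + 1 + 1) / 2 = k + 1 by omega, two_zpow_succ]

lemma levelHeight_even (k : ℤ) : levelHeight (2 * k) = 2 ^ k := by
  rw [levelHeight, show 2 * k / 2 = k by omega]

lemma levelHeight_odd (k : ℤ) : levelHeight (2 * k + 1) = 2 ^ k := by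
  rw [levelHeight, show (2 * k + 1) / 2 = k by omega]

lemma levelWidth_mono {s t : ℤ} (h : s ≤ t) : levelWidth s ≤ levelWidth t :=
  two_zpow_le (by omega)

lemma levelHeight_mono {s t : ℤ} (h : s ≤ t) : levelHeight s ≤ levelHeight t :=
  two_zpow_le (by omega)

/-- The dyadic block of level `s` with lower left corner `c`. -/
noncomputable def block (c : ℝ × ℝ) (s : ℤ) : Rct := ⟨c.1, c.2, levelWidth s, levelHeight s⟩

/-- Corner of the second half of the block of level `s + 1` with corner `c`. -/
noncomputable def buddy (c : ℝ × ℝ) (s : ℤ) : ℝ × ℝ :=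
  if Even s then (c.1 + levelWidth s, c.2) else (c.1, c.2 + levelHeight s)

lemma block_mono (c : ℝ × ℝ) {s t : ℤ} (h : s ≤ t) : (block c s).Le (block c t) :=
  ⟨le_rfl, by simpa [block] using levelWidth_mono h, le_rfl,
    by simpa [block] using levelHeight_mono h⟩

lemma block_buddy_le (c : ℝ × ℝ) (s : ℤ) : (block (buddy c s) s).Le (block c (s + 1)) := by
  rcases Int.even_or_odd' s with ⟨k, rfl | rfl⟩
  · have := two_zpow_pos k
    simp only [block, buddy, Rct.Le, levelWidth_odd, levelHeight_odd, levelWidth_even,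
      levelHeight_even, even_two_mul, if_true]
    refine ⟨?_, ?_, ?_, ?_⟩ <;> linarith
  · have := two_zpow_pos k
    have h : ¬ Even (2 * k + 1) := by simp
    rw [show 2 * k + 1 + 1 = 2 * (k + 1) by ring]
    simp only [block, buddy, Rct.Le, levelWidth_odd, levelHeight_odd, levelWidth_even,
      levelHeight_even, h, if_false, two_zpow_succ]
    refine ⟨?_, ?_, ?_, ?_⟩ <;> linarith

lemma block_buddy_sep (c : ℝ × ℝ) (s : ℤ) : (block (buddy c s) s).Sep (block c s) := by
  by_cases h : Even s
  · exact Or.inr (Or.inl (by simp [block, buddy, h]))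
  · exact Or.inr (Or.inr (Or.inr (by simp [block, buddy, h])))

lemma sum_two_zpow_le (A : Finset ℤ) : ∀ q : ℤ, (∀ s ∈ A, s < q) → ∑ s ∈ A, (2 : ℝ) ^ s ≤ 2 ^ q := by
  induction A using Finset.induction_on_max with
  | empty => intro q _; simpa using (two_zpow_pos q).le
  | insert a A ha ih =>
    intro q hq
    rw [Finset.sum_insert (fun h => lt_irrefl _ (ha a h))]
    have h1 := ih a ha
    have h2 := two_zpow_le (show a + 1 ≤ q from hq a (Finset.mem_insert_self _ _))
    rw [two_zpow_succ] at h2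
    linarith

lemma sum_union_of_lt {A B : Finset ℤ} (h : ∀ a ∈ A, ∀ b ∈ B, a < b) :
    ∑ s ∈ A ∪ B, (2 : ℝ) ^ s = ∑ s ∈ A, (2 : ℝ) ^ s + ∑ s ∈ B, (2 : ℝ) ^ s :=
  Finset.sum_union (Finset.disjoint_left.2 fun a ha hb => lt_irrefl a (h a ha a hb))

lemma sum_Ico_two_zpow {q t : ℤ} (h : q ≤ t) :
    ∑ s ∈ Finset.Ico q t, (2 : ℝ) ^ s = 2 ^ t - 2 ^ q := by
  induction t, h using Int.leInduction with
  | base => simp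
  | succ t h ih =>
    rw [← Finset.insert_Ico_right_eq_Ico_add_one h, Finset.sum_insert (by simp), ih, two_zpow_succ]
    ring

/-! ### Online allocation of dyadic blocks -/

/-- State of the block allocator. Home `m` is the square `[2^m, 2^(m+1)] × [0, 2^m]`. -/
structure Store where
  /-- Levels of the free blocks in each home. -/
  free : ℤ → Finset ℤ
  /-- Corner of the free block of a given level. -/
  pos : ℤ → ℝ × ℝ
  /-- Dimensions of the part of each home that is in use. -/
  ext : ℤ → ℝ × ℝ
  /-- Total area of the allocated blocks. -/
  area : ℝ

namespace Store

/-- The square of home `m`. -/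
noncomputable def home (m : ℤ) : Rct := ⟨2 ^ m, 0, 2 ^ m, 2 ^ m⟩

variable (D : Store)

/-- The free block of level `s`. -/
noncomputable def blk (s : ℤ) : Rct := block (D.pos s) s

/-- The part of home `m` that is in use. -/
noncomputable def used (m : ℤ) : Rct := ⟨2 ^ m, 0, (D.ext m).1, (D.ext m).2⟩

/-- Allocated area in home `m`. -/
noncomputable def usedArea (m : ℤ) : ℝ := 2 ^ m * 2 ^ m - ∑ s ∈ D.free m, 2 ^ s

/-- How far a home has been filled, together with a lower bound on the total allocated area. -/
inductive Stage (m : ℤ) : Prop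
  | untouched (free : D.free m = {2 * m}) (pos : D.pos (2 * m) = (2 ^ m, 0))
      (ext : D.ext m = (0, 0))
  | quarter (mem_half : 2 * m - 1 ∈ D.free m) (mem_quarter : 2 * m - 2 ∈ D.free m)
      (lt : ∀ s ∈ D.free m, s < 2 * m)
      (le : ∀ s ∈ D.free m, s < 2 * m - 2 → (D.blk s).Le (D.used m))
      (ext : D.ext m = (2 ^ m / 2, 2 ^ m / 2))
      (area : 21 / 64 * (2 ^ m * 2 ^ m) ≤ D.area)
  | half (free : D.free m = {2 * m - 1}) (ext : D.ext m = (2 ^ m, 2 ^ m / 2))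
      (area : 1 / 2 * (2 ^ m * 2 ^ m) ≤ D.area)
  | crowded (ext : D.ext m = (2 ^ m, 2 ^ m)) (area : 37 / 64 * (2 ^ m * 2 ^ m) ≤ D.area)

/-- Invariants of the block allocator. -/
structure Valid : Prop where
  order : ∀ {m n s t : ℤ}, m < n → s ∈ D.free m → t ∈ D.free n → s < t
  le_two_mul : ∀ {m s : ℤ}, s ∈ D.free m → s ≤ 2 * m
  blk_le : ∀ {m s : ℤ}, s ∈ D.free m → (D.blk s).Le (home m)
  sep : ∀ {m n s t : ℤ}, s ∈ D.free m → t ∈ D.free n → s ≠ t → (D.blk s).Sep (D.blk t)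
  stage : ∀ m, D.Stage m
  eventually_free : ∃ N, ∀ m, N ≤ m → D.free m = {2 * m}
  area_nonneg : 0 ≤ D.area
  usedArea_le : ∀ m,
    D.usedArea m + D.usedArea (m - 1) + D.usedArea (m - 2) + D.usedArea (m - 3) ≤ D.area

/-- The allocator before the first request. -/
noncomputable def init : Store where
  free m := {2 * m}
  pos s := (2 ^ (s / 2), 0)
  ext _ := (0, 0)
  area := 0

lemma init_blk (m : ℤ) : init.blk (2 * m) = home m := by
  simp [blk, block, init, home, levelWidth_even, levelHeight_even]

lemma home_sep {m n : ℤ} (h : m < n) : (home m).Sep (home n) := by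
  have h1 := two_zpow_le (show m + 1 ≤ n from h)
  rw [two_zpow_succ] at h1
  exact Or.inl (by simp only [home]; linarith)

lemma init_valid : init.Valid where
  order := by
    intro m n s t h hs ht
    simp only [init, Finset.mem_singleton] at hs ht
    omega
  le_two_mul := by
    intro m s hs
    simp only [init, Finset.mem_singleton] at hs
    omega
  blk_le := by
    intro m s hs
    simp only [init, Finset.mem_singleton] at hs
    rw [hs, init_blk]
    exact Rct.Le.refl _
  sep := by
    intro m n s t hs ht hne
    simp only [init, Finset.mem_singleton] at hs ht
    rw [hs, ht, init_blk, init_blk]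
    rcases lt_trichotomy m n with h | h | h
    · exact home_sep h
    · omega
    · exact (home_sep h).symm
  stage m := .untouched rfl (by simp [init]) rfl
  eventually_free := ⟨0, fun _ _ => rfl⟩
  area_nonneg := le_rfl
  usedArea_le m := by simp [usedArea, init, two_zpow_two_mul]

/-- Allocate a block of level `q` out of the free block of level `t` in home `m`. -/
noncomputable def alloc (q t m : ℤ) (e : ℝ × ℝ) : Store where
  free := Function.update D.free m ((D.free m).erase t ∪ Finset.Ico q t)
  pos s := if q ≤ s ∧ s < t then buddy (D.pos t) s else D.pos s
  ext := Function.update D.ext m e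
  area := D.area + 2 ^ q

variable {D}

/-- The free block used for a request of level `q`: the smallest one of level at least `q`. -/
structure BestFit (D : Store) (q t m : ℤ) : Prop where
  mem : t ∈ D.free m
  le : q ≤ t
  min : ∀ n s, s ∈ D.free n → q ≤ s → t ≤ s

lemma Valid.exists_bestFit (hD : D.Valid) (q : ℤ) : ∃ m t, D.BestFit q t m := by
  obtain ⟨N, hN⟩ := hD.eventually_free
  obtain ⟨t, ⟨hq, m, hm⟩, hmin⟩ := Int.exists_least_of_bdd
    (P := fun t => q ≤ t ∧ ∃ m, t ∈ D.free m) ⟨q, fun z hz => hz.1⟩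
    ⟨2 * max N q.natAbs, by omega, max N q.natAbs, by
      rw [hN _ (le_max_left _ _)]; exact Finset.mem_singleton_self _⟩
  exact ⟨m, t, hm, hq, fun n s hs hqs => hmin s ⟨hqs, n, hs⟩⟩

section

variable {q t m : ℤ} {e : ℝ × ℝ}

lemma alloc_free_self : (D.alloc q t m e).free m = (D.free m).erase t ∪ Finset.Ico q t := by
  simp [alloc]

lemma alloc_free_of_ne {n : ℤ} (h : n ≠ m) : (D.alloc q t m e).free n = D.free n := by
  simp [alloc, h]

lemma alloc_blk_of_mem {s : ℤ} (h : q ≤ s ∧ s < t) :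
    (D.alloc q t m e).blk s = block (buddy (D.pos t) s) s := by
  simp [blk, alloc, h]

lemma alloc_blk_of_not_mem {s : ℤ} (h : ¬ (q ≤ s ∧ s < t)) :
    (D.alloc q t m e).blk s = D.blk s := by
  simp only [blk, alloc, h, if_false]

/-- A free block after the allocation is a remainder of the split block or an old free block. -/
lemma mem_alloc_free {n s : ℤ} (h : s ∈ (D.alloc q t m e).free n) :
    (n = m ∧ q ≤ s ∧ s < t) ∨ (s ∈ D.free n ∧ (n = m → s ≠ t)) := by
  by_cases hn : n = m
  · subst hn
    rw [alloc_free_self, Finset.mem_union, Finset.mem_erase, Finset.mem_Ico] at h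
    tauto
  · rw [alloc_free_of_ne hn] at h
    tauto

lemma BestFit.not_mem (hb : D.BestFit q t m) {n s : ℤ} (h : s ∈ D.free n) :
    ¬ (q ≤ s ∧ s < t) := fun h' =>
  absurd (hb.min n s h h'.1) (by omega)

lemma BestFit.alloc_blk_old (hb : D.BestFit q t m) {n s : ℤ} (h : s ∈ D.free n) :
    (D.alloc q t m e).blk s = D.blk s :=
  alloc_blk_of_not_mem (hb.not_mem h)

lemma remainder_le {s : ℤ} (h : s < t) :
    (block (buddy (D.pos t) s) s).Le (D.blk t) :=
  (block_buddy_le _ _).trans (block_mono _ h)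

lemma BestFit.allocated_le (hb : D.BestFit q t m) : (block (D.pos t) q).Le (D.blk t) :=
  block_mono _ hb.le

/-- Every free block after the allocation lies in a free block from before it. -/
lemma BestFit.alloc_blk_le (hb : D.BestFit q t m) {n s : ℤ} (h : s ∈ (D.alloc q t m e).free n) :
    ∃ u, u ∈ D.free n ∧ ((D.alloc q t m e).blk s).Le (D.blk u) := by
  rcases mem_alloc_free h with ⟨rfl, h1⟩ | ⟨h1, -⟩
  · exact ⟨t, hb.mem, by rw [alloc_blk_of_mem h1]; exact remainder_le h1.2⟩
  · exact ⟨s, h1, by rw [hb.alloc_blk_old h1]; exact Rct.Le.refl _⟩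

lemma BestFit.ne_of_ne (hD : D.Valid) (hb : D.BestFit q t m) {n s : ℤ} (h : s ∈ D.free n)
    (h' : n = m → s ≠ t) : s ≠ t := by
  rintro rfl
  rcases lt_trichotomy n m with hn | hn | hn
  · exact lt_irrefl _ (hD.order hn h hb.mem)
  · exact h' hn rfl
  · exact lt_irrefl _ (hD.order hn hb.mem h)

lemma BestFit.allocated_sep (hD : D.Valid) (hb : D.BestFit q t m) {n s : ℤ}
    (h : s ∈ (D.alloc q t m e).free n) :
    (block (D.pos t) q).Sep ((D.alloc q t m e).blk s) := by
  rcases mem_alloc_free h with ⟨rfl, h1⟩ | ⟨h1, h2⟩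
  · rw [alloc_blk_of_mem h1]
    exact ((block_buddy_sep _ _).mono (Rct.Le.refl _) (block_mono _ h1.1)).symm
  · rw [hb.alloc_blk_old h1]
    exact (hD.sep hb.mem h1 (hb.ne_of_ne hD h1 h2).symm).mono hb.allocated_le (Rct.Le.refl _)

lemma BestFit.alloc_order (hD : D.Valid) (hb : D.BestFit q t m) {n n' s s' : ℤ} (hn : n < n')
    (h : s ∈ (D.alloc q t m e).free n)
    (h' : s' ∈ (D.alloc q t m e).free n') : s < s' := by
  rcases mem_alloc_free h with ⟨rfl, h1⟩ | ⟨h1, -⟩ <;>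
    rcases mem_alloc_free h' with ⟨rfl, h2⟩ | ⟨h2, -⟩
  · omega
  · exact h1.2.trans (hD.order hn hb.mem h2)
  · have h3 := hD.order hn h1 hb.mem
    by_contra h4
    exact absurd (hb.min n s h1 (by omega)) (by omega)
  · exact hD.order hn h1 h2

lemma BestFit.alloc_sep (hD : D.Valid) (hb : D.BestFit q t m) {n n' s s' : ℤ}
    (h : s ∈ (D.alloc q t m e).free n)
    (h' : s' ∈ (D.alloc q t m e).free n') (hne : s ≠ s') :
    ((D.alloc q t m e).blk s).Sep ((D.alloc q t m e).blk s') := by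
  rcases mem_alloc_free h with ⟨rfl, h1⟩ | ⟨h1, h1'⟩ <;>
    rcases mem_alloc_free h' with ⟨rfl, h2⟩ | ⟨h2, h2'⟩
  · rw [alloc_blk_of_mem h1, alloc_blk_of_mem h2]
    rcases lt_or_gt_of_ne hne with h3 | h3
    · exact (block_buddy_sep (D.pos t) s').symm.mono
        ((block_buddy_le _ _).trans (block_mono _ h3)) (Rct.Le.refl _)
    · exact (block_buddy_sep (D.pos t) s).mono (Rct.Le.refl _)
        ((block_buddy_le _ _).trans (block_mono _ h3))
  · rw [alloc_blk_of_mem h1, hb.alloc_blk_old h2]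
    exact (hD.sep hb.mem h2 (hb.ne_of_ne hD h2 h2').symm).mono (remainder_le h1.2)
      (Rct.Le.refl _)
  · rw [alloc_blk_of_mem h2, hb.alloc_blk_old h1]
    exact (hD.sep h1 hb.mem (hb.ne_of_ne hD h1 h1')).mono (Rct.Le.refl _)
      (remainder_le h2.2)
  · rw [hb.alloc_blk_old h1, hb.alloc_blk_old h2]
    exact hD.sep h1 h2 hne

lemma BestFit.usedArea_alloc_self (hb : D.BestFit q t m) :
    (D.alloc q t m e).usedArea m = D.usedArea m + 2 ^ q := by
  have hdis : Disjoint ((D.free m).erase t) (Finset.Ico q t) :=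
    Finset.disjoint_left.2 fun s hs hs' =>
      hb.not_mem (Finset.mem_of_mem_erase hs) (Finset.mem_Ico.1 hs')
  rw [usedArea, usedArea, alloc_free_self, Finset.sum_union hdis, sum_Ico_two_zpow hb.le,
    ← Finset.add_sum_erase _ _ hb.mem]
  ring

lemma usedArea_alloc_of_ne {n : ℤ} (h : n ≠ m) :
    (D.alloc q t m e).usedArea n = D.usedArea n := by
  rw [usedArea, usedArea, alloc_free_of_ne h]

lemma BestFit.usedArea_alloc_le (hD : D.Valid) (hb : D.BestFit q t m) (n : ℤ) :
    (D.alloc q t m e).usedArea n + (D.alloc q t m e).usedArea (n - 1) +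
      (D.alloc q t m e).usedArea (n - 2) + (D.alloc q t m e).usedArea (n - 3) ≤
      (D.alloc q t m e).area := by
  have h := hD.usedArea_le n
  have hq := two_zpow_pos q
  have key : ∀ k, (D.alloc q t m e).usedArea k = D.usedArea k + if k = m then 2 ^ q else 0 := by
    intro k
    split_ifs with hk
    · rw [hk, hb.usedArea_alloc_self]
    · rw [usedArea_alloc_of_ne hk, add_zero]
  rw [key, key, key, key]
  simp only [alloc]
  split_ifs <;> first | omega | linarith

/-- The allocator is nearly full below the home from which a request is served. -/
lemma BestFit.le_area (hD : D.Valid) (hb : D.BestFit q t m) :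
    21 / 64 * (2 ^ m * 2 ^ m) + D.usedArea m + ∑ s ∈ D.free m with s < q, (2 : ℝ) ^ s ≤
      D.area + 2 ^ q := by
  have lower : ∀ {n}, n < m → ∀ s ∈ D.free n, s < q := by
    intro n hn s hs
    by_contra h
    exact absurd (hb.min n s hs (by omega)) (not_le.2 (hD.order hn hs hb.mem))
  have hsum := sum_two_zpow_le
    (((D.free (m - 3) ∪ D.free (m - 2)) ∪ D.free (m - 1)) ∪ {s ∈ D.free m | s < q}) q (by
      intro s hs
      simp only [Finset.mem_union, Finset.mem_filter] at hs
      rcases hs with ((hs | hs) | hs) | hs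
      · exact lower (by omega) s hs
      · exact lower (by omega) s hs
      · exact lower (by omega) s hs
      · exact hs.2)
  rw [sum_union_of_lt, sum_union_of_lt, sum_union_of_lt] at hsum
  · have h := hD.usedArea_le m
    have e2 : (2 : ℝ) ^ (m - 2) = 2 ^ m / 4 := by
      rw [show m - 2 = m - 1 - 1 by ring, two_zpow_pred, two_zpow_pred]; ring
    have e3 : (2 : ℝ) ^ (m - 3) = 2 ^ m / 8 := by
      rw [show m - 3 = m - 2 - 1 by ring, two_zpow_pred, e2]; ring
    simp only [usedArea, two_zpow_pred, e2, e3] at h ⊢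
    linarith
  · exact fun a ha b hb => hD.order (by omega) ha hb
  · intro a ha b hb
    rcases Finset.mem_union.1 ha with ha | ha <;> exact hD.order (by omega) ha hb
  · intro a ha b hb
    have hb := (Finset.mem_filter.1 hb).1
    rcases Finset.mem_union.1 ha with ha | ha
    · rcases Finset.mem_union.1 ha with ha | ha <;> exact hD.order (by omega) ha hb
    · exact hD.order (by omega) ha hb

lemma BestFit.stage_alloc_of_ne (hb : D.BestFit q t m) {n : ℤ} (hn : n ≠ m) (h : D.Stage n) :
    (D.alloc q t m e).Stage n := by
  have hq := two_zpow_pos q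
  have hext : (D.alloc q t m e).ext n = D.ext n := by simp [alloc, hn]
  have hfree := alloc_free_of_ne (D := D) (q := q) (t := t) (e := e) hn
  have hpos : ∀ s ∈ D.free n, (D.alloc q t m e).pos s = D.pos s := by
    intro s hs
    have := hb.not_mem hs
    simp only [alloc, this, if_false]
  have harea : (D.alloc q t m e).area = D.area + 2 ^ q := rfl
  cases h with
  | untouched h1 h2 h3 =>
    refine .untouched (hfree.trans h1) ?_ (hext.trans h3)
    rw [hpos _ (by rw [h1]; exact Finset.mem_singleton_self _), h2]
  | quarter h1 h2 h3 h4 h5 h6 =>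
    refine .quarter (hfree ▸ h1) (hfree ▸ h2) (hfree ▸ h3) ?_ (hext.trans h5) (by linarith)
    intro s hs hs'
    rw [hfree] at hs
    rw [hb.alloc_blk_old hs, used, hext]
    exact h4 s hs hs'
  | half h1 h2 h3 => exact .half (hfree.trans h1) (hext.trans h2) (by linarith)
  | crowded h1 h2 => exact .crowded (hext.trans h1) (by linarith)

lemma Valid.ext_bounds (hD : D.Valid) (n : ℤ) : (D.ext n).1 ≤ 2 ^ n ∧ (D.ext n).2 ≤ 2 ^ n := by
  have hn := two_zpow_pos n
  cases hD.stage n with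
  | untouched _ _ h => rw [h]; exact ⟨hn.le, hn.le⟩
  | quarter _ _ _ _ h _ => rw [h]; constructor <;> simp only <;> linarith
  | half _ h _ => rw [h]; constructor <;> simp only <;> linarith
  | crowded h _ => rw [h]; exact ⟨le_rfl, le_rfl⟩

/-- The effect of a request on the home from which it is served. -/
lemma BestFit.exists_stage_alloc_self (hD : D.Valid) (hb : D.BestFit q t m) : ∃ e : ℝ × ℝ,
    (D.alloc q t m e).Stage m ∧
    (block (D.pos t) q).Le ((D.alloc q t m e).used m) ∧
    (D.used m).Le ((D.alloc q t m e).used m) := by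
  have hz := two_zpow_pos m
  have hzz := mul_pos hz hz
  have hq := two_zpow_pos q
  have htm : t ≤ 2 * m := hD.le_two_mul hb.mem
  have e0 := two_zpow_two_mul m
  have e1 : (2 : ℝ) ^ (2 * m - 1) = 2 ^ m * 2 ^ m / 2 := by rw [two_zpow_pred, e0]
  have e2 : (2 : ℝ) ^ (2 * m - 2) = 2 ^ m * 2 ^ m / 4 := by
    rw [show 2 * m - 2 = 2 * m - 1 - 1 by ring, two_zpow_pred, e1]; ring
  have hext : ∀ e, (D.alloc q t m e).ext m = e := fun e => by simp [alloc]
  have harea : ∀ e, (D.alloc q t m e).area = D.area + 2 ^ q := fun e => rfl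
  have hle := hb.le_area hD
  have hfilter : 0 ≤ ∑ s ∈ D.free m with s < q, (2 : ℝ) ^ s :=
    Finset.sum_nonneg fun s _ => (two_zpow_pos s).le
  have b1 : levelWidth (2 * m - 1) = 2 ^ m ∧ levelHeight (2 * m - 1) = 2 ^ m / 2 := by
    rw [show 2 * m - 1 = 2 * (m - 1) + 1 by ring, levelWidth_odd, levelHeight_odd, two_zpow_pred]
    exact ⟨by ring, rfl⟩
  have b2 : levelWidth (2 * m - 2) = 2 ^ m / 2 ∧ levelHeight (2 * m - 2) = 2 ^ m / 2 := by
    rw [show 2 * m - 2 = 2 * (m - 1) by ring, levelWidth_even, levelHeight_even, two_zpow_pred]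
    exact ⟨rfl, rfl⟩
  have full : 37 / 64 * (2 ^ m * 2 ^ m) ≤ D.area + 2 ^ q → ∃ e : ℝ × ℝ,
      (D.alloc q t m e).Stage m ∧ (block (D.pos t) q).Le ((D.alloc q t m e).used m) ∧
      (D.used m).Le ((D.alloc q t m e).used m) := by
    intro h
    obtain ⟨h1, h2⟩ := hD.ext_bounds m
    refine ⟨(2 ^ m, 2 ^ m), .crowded (hext _) h, ?_, ?_⟩
    · have := hb.allocated_le.trans (hD.blk_le hb.mem)
      rwa [used, hext]
    · rw [used, used, hext]
      exact ⟨le_rfl, by simpa using h1, le_rfl, by simpa using h2⟩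
  have harea0 := hD.area_nonneg
  cases hD.stage m with
  | untouched h1 h2 h3 =>
    have ht : t = 2 * m := by simpa [h1] using hb.mem
    subst ht
    have hu : D.usedArea m = 0 := by simp [usedArea, h1, e0]
    have hfree : ∀ e, (D.alloc q (2 * m) m e).free m = Finset.Ico q (2 * m) := by
      intro e
      rw [alloc_free_self, h1]
      simp
    have hused : ∀ x y : ℝ, 0 ≤ x → 0 ≤ y →
        (D.used m).Le ((D.alloc q (2 * m) m (x, y)).used m) := by
      intro x y hx hy
      rw [used, used, hext, h3]
      exact ⟨le_rfl, by simpa using hx, le_rfl, by simpa using hy⟩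
    rcases (show q = 2 * m ∨ q = 2 * m - 1 ∨ q ≤ 2 * m - 2 by have := hb.le; omega)
      with rfl | rfl | h
    · exact full (by linarith)
    · refine ⟨(2 ^ m, 2 ^ m / 2), .half ?_ (hext _) ?_, ?_, hused _ _ hz.le (by linarith)⟩
      · rw [hfree]
        ext s
        simp only [Finset.mem_Ico, Finset.mem_singleton]
        omega
      · rw [harea]; linarith
      · rw [used, hext, h2, block, b1.1, b1.2]
        exact Rct.Le.refl _
    · refine ⟨(2 ^ m / 2, 2 ^ m / 2), .quarter ?_ ?_ ?_ ?_ (hext _) ?_, ?_,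
        hused _ _ (by linarith) (by linarith)⟩
      · rw [hfree, Finset.mem_Ico]; omega
      · rw [hfree, Finset.mem_Ico]; omega
      · intro s hs
        rw [hfree, Finset.mem_Ico] at hs
        exact hs.2
      · intro s hs hs'
        rw [hfree, Finset.mem_Ico] at hs
        rw [alloc_blk_of_mem hs, used, hext, h2]
        have := (block_buddy_le (2 ^ m, 0) s).trans (block_mono _ (show s + 1 ≤ 2 * m - 2 by omega))
        rwa [block.eq_1 _ (2 * m - 2), b2.1, b2.2] at this
      · rw [harea]; linarith
      · rw [used, hext, h2]
        have := block_mono (2 ^ m, 0) h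
        rwa [block.eq_1 _ (2 * m - 2), b2.1, b2.2] at this
  | quarter h1 h2 h3 h4 h5 h6 =>
    have ht := h3 t hb.mem
    rcases (show t = 2 * m - 1 ∨ t = 2 * m - 2 ∨ t < 2 * m - 2 by omega) with rfl | rfl | h
    · have : q = 2 * m - 1 := by
        by_contra hne
        have := hb.le
        exact absurd (hb.min m _ h2 (by omega)) (by omega)
      subst this
      exact full (by linarith)
    · apply full
      have hsplit := Finset.sum_filter_add_sum_filter_not (D.free m) (· < q) fun s => (2 : ℝ) ^ s
      have hsub : {s ∈ D.free m | ¬ s < q} ⊆ {2 * m - 1, 2 * m - 2} := by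
        intro s hs
        obtain ⟨hs, hs'⟩ := Finset.mem_filter.1 hs
        have := hb.min m s hs (by omega)
        have := h3 s hs
        simp only [Finset.mem_insert, Finset.mem_singleton]
        omega
      have hsum := Finset.sum_le_sum_of_subset_of_nonneg hsub
        fun s _ _ => (two_zpow_pos s).le
      rw [Finset.sum_pair (by omega), e1, e2] at hsum
      rw [usedArea] at hle
      linarith
    · have hused : (D.alloc q t m (2 ^ m / 2, 2 ^ m / 2)).used m = D.used m := by
        rw [used, used, hext, h5]
      refine ⟨(2 ^ m / 2, 2 ^ m / 2), .quarter ?_ ?_ ?_ ?_ (hext _) ?_, ?_, ?_⟩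
      · rw [alloc_free_self, Finset.mem_union, Finset.mem_erase]
        exact Or.inl ⟨by omega, h1⟩
      · rw [alloc_free_self, Finset.mem_union, Finset.mem_erase]
        exact Or.inl ⟨by omega, h2⟩
      · intro s hs
        rcases mem_alloc_free hs with ⟨-, hs⟩ | ⟨hs, -⟩
        · omega
        · exact h3 s hs
      · intro s hs hs'
        rw [hused]
        rcases mem_alloc_free hs with ⟨-, hs⟩ | ⟨hs, -⟩
        · rw [alloc_blk_of_mem hs]
          exact (remainder_le hs.2).trans (h4 t hb.mem h)
        · rw [hb.alloc_blk_old hs]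
          exact h4 s hs hs'
      · rw [harea]; linarith
      · rw [hused]
        exact hb.allocated_le.trans (h4 t hb.mem h)
      · rw [hused]
        exact Rct.Le.refl _
  | half h1 h2 h3 =>
    apply full
    have hu : D.usedArea m = 2 ^ m * 2 ^ m / 2 := by
      rw [usedArea, h1, Finset.sum_singleton, e1]; ring
    linarith
  | crowded h1 h2 => exact full (by linarith)

/-- A valid allocator can serve any request and stays valid. -/
lemma BestFit.exists_alloc_valid (hD : D.Valid) (hb : D.BestFit q t m) : ∃ e : ℝ × ℝ,
    (D.alloc q t m e).Valid ∧
    (block (D.pos t) q).Le ((D.alloc q t m e).used m) ∧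
    (D.used m).Le ((D.alloc q t m e).used m) := by
  obtain ⟨e, h1, h2, h3⟩ := hb.exists_stage_alloc_self hD
  refine ⟨e, ?_, h2, h3⟩
  exact
    { order := hb.alloc_order hD
      le_two_mul := by
        intro n s hs
        rcases mem_alloc_free hs with ⟨rfl, -, h⟩ | ⟨h, -⟩
        · exact h.le.trans (hD.le_two_mul hb.mem)
        · exact hD.le_two_mul h
      blk_le := by
        intro n s hs
        obtain ⟨u, hu, hle⟩ := hb.alloc_blk_le hs
        exact hle.trans (hD.blk_le hu)
      sep := hb.alloc_sep hD
      stage := by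
        intro n
        by_cases hn : n = m
        · rwa [hn]
        · exact hb.stage_alloc_of_ne hn (hD.stage n)
      eventually_free := by
        obtain ⟨N, hN⟩ := hD.eventually_free
        refine ⟨max N (m + 1), fun n hn => ?_⟩
        rw [alloc_free_of_ne (by have := le_max_right N (m + 1); omega)]
        exact hN n ((le_max_left _ _).trans hn)
      area_nonneg := add_nonneg hD.area_nonneg (two_zpow_pos q).le
      usedArea_le := hb.usedArea_alloc_le hD }

end

/-- `D'` results from `D` by allocating the block of level `q` with corner `c` in home `m`. -/
structure Serves (D D' : Store) (q : ℤ) (c : ℝ × ℝ) (m : ℤ) : Prop where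
  valid : D'.Valid
  area : D'.area = D.area + 2 ^ q
  used_le : ∀ n, (D.used n).Le (D'.used n)
  le_used : (block c q).Le (D'.used m)
  le_blk : ∃ n t, t ∈ D.free n ∧ (block c q).Le (D.blk t)
  blk_le : ∀ {n s}, s ∈ D'.free n → ∃ u, u ∈ D.free n ∧ (D'.blk s).Le (D.blk u)
  sep : ∀ {n s}, s ∈ D'.free n → (block c q).Sep (D'.blk s)

/-- A valid allocator can serve any request. -/
lemma Valid.exists_serves (hD : D.Valid) (q : ℤ) : ∃ D' c m, D.Serves D' q c m := by
  obtain ⟨m, t, hb⟩ := hD.exists_bestFit q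
  obtain ⟨e, h1, h2, h3⟩ := hb.exists_alloc_valid hD
  refine ⟨D.alloc q t m e, D.pos t, m, h1, rfl, fun n => ?_, h2, ⟨m, t, hb.mem, hb.allocated_le⟩,
    hb.alloc_blk_le, hb.allocated_sep hD⟩
  by_cases hn : n = m
  · rwa [hn]
  · have : (D.alloc q t m e).ext n = D.ext n := by simp [alloc, hn]
    rw [used, used, this]
    exact Rct.Le.refl _

end Store

/-! ### The online packing -/

/-- A piece together with the point at which it is placed. -/
abbrev Placed := Piece × (ℝ × ℝ)

/-- The rectangle covered by a placed piece. -/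
def Placed.rct (e : Placed) : Rct := ⟨e.2.1, e.2.2, e.1.1, e.1.2⟩

/-- Total area of the placed pieces. -/
noncomputable def totalArea (P : List Placed) : ℝ := (P.map fun e => e.1.1 * e.1.2).sum

lemma totalArea_cons (e : Placed) (P : List Placed) :
    totalArea (e :: P) = e.1.1 * e.1.2 + totalArea P := by
  simp [totalArea]

/-- State of the online packing. Flat pieces of length in `(2^m, 2^(m+1)]` are stacked in the
strip of class `m`: first in the shelf `[0, 2^(m+1)] × [2^m, 2^(m+1)]`, then in allocated blocks. -/
structure Packer where
  store : Store
  /-- Corner of the unfilled part of the strip. -/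
  corner : ℤ → ℝ × ℝ
  /-- Filled height of the strip. -/
  fill : ℤ → ℝ
  /-- Filled height of the shelf. -/
  shelf : ℤ → ℝ
  /-- Home of the strip, or `none` if it is the shelf. -/
  tag : ℤ → Option ℤ

namespace Packer

variable (Q : Packer)

/-- The unfilled part of the strip of class `m`. -/
noncomputable def strip (m : ℤ) : Rct :=
  ⟨(Q.corner m).1, (Q.corner m).2, 2 * 2 ^ m, 2 ^ m - Q.fill m⟩

/-- The filled part of the shelf of class `m`. -/
noncomputable def shelfRct (m : ℤ) : Rct := ⟨0, 2 ^ m, 2 * 2 ^ m, Q.shelf m⟩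

/-- Invariants of the online packing. -/
structure Valid (P : List Placed) : Prop where
  store : Q.store.Valid
  fill_nonneg : ∀ m, 0 ≤ Q.fill m
  shelf_nonneg : ∀ m, 0 ≤ Q.shelf m
  shelf_le : ∀ m, Q.shelf m ≤ 2 ^ m
  blk_sep_strip : ∀ {n s} m, s ∈ Q.store.free n → (Q.store.blk s).Sep (Q.strip m)
  strip_sep : ∀ {m n}, m ≠ n → (Q.strip m).Sep (Q.strip n)
  rct_sep_blk : ∀ e ∈ P, ∀ {n s}, s ∈ Q.store.free n → e.rct.Sep (Q.store.blk s)
  rct_sep_strip : ∀ e ∈ P, ∀ m, e.rct.Sep (Q.strip m)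
  pairwise : P.Pairwise fun e e' => e.rct.Sep e'.rct
  of_none : ∀ {m}, Q.tag m = none → Q.corner m = (0, 2 ^ m + Q.shelf m) ∧ Q.fill m = Q.shelf m
  of_some : ∀ {m n}, Q.tag m = some n →
    (Q.strip m).Le (Q.store.used n) ∧ 2 ^ m * 2 ^ m ≤ totalArea P
  location : ∀ e ∈ P, (∃ m, e.rct.Le (Q.shelfRct m) ∧ 2 ^ m < e.1.1) ∨
    ∃ n, e.rct.Le (Q.store.used n)
  pos : ∀ e ∈ P, PiecePos e.1
  area : ∀ J : Finset ℤ, Q.store.area / 4 + ∑ m ∈ J, 2 ^ m * Q.fill m ≤ totalArea P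

/-- The state before the first piece. -/
noncomputable def init : Packer where
  store := Store.init
  corner m := (0, 2 ^ m)
  fill _ := 0
  shelf _ := 0
  tag _ := none

lemma init_valid : init.Valid [] where
  store := Store.init_valid
  fill_nonneg _ := le_rfl
  shelf_nonneg _ := le_rfl
  shelf_le m := (two_zpow_pos m).le
  blk_sep_strip := by
    intro n s m hs
    have hs : s = 2 * n := by simpa [init, Store.init] using hs
    have h : (init.store.blk s) = Store.home n := by rw [hs]; exact Store.init_blk n
    rw [h]
    rcases le_or_gt n m with hn | hn
    · have := two_zpow_le hn
      exact Or.inr (Or.inr (Or.inl (by simpa [Store.home, strip, init] using this)))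
    · have := two_zpow_le (show m + 1 ≤ n from hn)
      rw [two_zpow_succ] at this
      exact Or.inr (Or.inl (by simpa [Store.home, strip, init] using this))
  strip_sep := by
    have key : ∀ {m n}, m < n → (init.strip m).Sep (init.strip n) := by
      intro m n h
      have := two_zpow_le (show m + 1 ≤ n from h)
      rw [two_zpow_succ] at this
      exact Or.inr (Or.inr (Or.inl (by simp only [strip, init]; linarith)))
    intro m n h
    rcases lt_or_gt_of_ne h with h | h
    · exact key h
    · exact (key h).symm
  rct_sep_blk := by simp
  rct_sep_strip := by simp
  pairwise := List.Pairwise.nil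
  of_none := by simp [init]
  of_some := by simp [init]
  location := by simp
  pos := by simp
  area := by simp [init, Store.init, totalArea]

variable {Q} {P : List Placed}

/-- A flat piece that fits in the strip of its class is put on top of the strip. -/
lemma Valid.stack (hQ : Q.Valid P) {p : Piece} (hp : PiecePos p) {m : ℤ} (h1 : 2 ^ m < p.1)
    (h2 : p.1 ≤ 2 * 2 ^ m)
    (h3 : Q.fill m + p.2 ≤ 2 ^ m) :
    ∃ Q' : Packer, Q'.Valid ((p, Q.corner m) :: P) := by
  obtain ⟨hp1, hp2⟩ := hp
  have hm := two_zpow_pos m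
  set Q' : Packer :=
    { store := Q.store
      corner := Function.update Q.corner m ((Q.corner m).1, (Q.corner m).2 + p.2)
      fill := Function.update Q.fill m (Q.fill m + p.2)
      shelf := Function.update Q.shelf m
        (if Q.tag m = none then Q.shelf m + p.2 else Q.shelf m)
      tag := Q.tag } with hQ'
  have strip_of_ne : ∀ {n}, n ≠ m → Q'.strip n = Q.strip n := by
    intro n hn
    simp [strip, hQ', hn]
  have strip_self : Q'.strip m =
      ⟨(Q.corner m).1, (Q.corner m).2 + p.2, 2 * 2 ^ m, 2 ^ m - (Q.fill m + p.2)⟩ := by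
    simp [strip, hQ']
  have strip_le : ∀ n, (Q'.strip n).Le (Q.strip n) := by
    intro n
    by_cases hn : n = m
    · subst hn
      rw [strip_self, strip]
      refine ⟨le_rfl, le_rfl, ?_, ?_⟩ <;> simp only <;> linarith
    · rw [strip_of_ne hn]
      exact Rct.Le.refl _
  have rct_le : Placed.rct (p, Q.corner m) |>.Le (Q.strip m) := by
    refine ⟨le_rfl, ?_, le_rfl, ?_⟩ <;> simp only [Placed.rct, strip] <;> linarith
  have shelf_ge : ∀ n, Q.shelf n ≤ Q'.shelf n := by
    intro n
    by_cases hn : n = m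
    · subst hn
      simp only [hQ', Function.update_self]
      split_ifs <;> linarith
    · simp [hQ', hn]
  have hA := totalArea_cons (p, Q.corner m) P
  have hpp := mul_pos hp1 hp2
  refine ⟨Q', ?_⟩
  exact
    { store := hQ.store
      fill_nonneg := by
        intro n
        by_cases hn : n = m
        · subst hn
          simp only [hQ', Function.update_self]
          linarith [hQ.fill_nonneg n]
        · simpa [hQ', hn] using hQ.fill_nonneg n
      shelf_nonneg := fun n => (hQ.shelf_nonneg n).trans (shelf_ge n)
      shelf_le := by
        intro n
        by_cases hn : n = m
        · subst hn
          simp only [hQ', Function.update_self]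
          split_ifs with h
          · rw [← (hQ.of_none h).2]; exact h3
          · exact hQ.shelf_le n
        · simpa [hQ', hn] using hQ.shelf_le n
      blk_sep_strip := fun n hs => (hQ.blk_sep_strip n hs).mono (Rct.Le.refl _) (strip_le n)
      strip_sep := fun h => (hQ.strip_sep h).mono (strip_le _) (strip_le _)
      rct_sep_blk := by
        intro e he n s hs
        rcases List.mem_cons.1 he with rfl | he
        · exact (hQ.blk_sep_strip m hs).symm.mono rct_le (Rct.Le.refl _)
        · exact hQ.rct_sep_blk e he hs
      rct_sep_strip := by
        intro e he n
        rcases List.mem_cons.1 he with rfl | he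
        · by_cases hn : n = m
          · subst hn
            rw [strip_self]
            exact Or.inr (Or.inr (Or.inl le_rfl))
          · exact (hQ.strip_sep (Ne.symm hn)).mono rct_le (strip_le n)
        · exact (hQ.rct_sep_strip e he n).mono (Rct.Le.refl _) (strip_le n)
      pairwise := List.pairwise_cons.2
        ⟨fun e he => (hQ.rct_sep_strip e he m).symm.mono rct_le (Rct.Le.refl _), hQ.pairwise⟩
      of_none := by
        intro n hn
        obtain ⟨k1, k2⟩ := hQ.of_none (m := n) hn
        by_cases hnm : n = m
        · subst hnm
          have hn : Q.tag n = none := hn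
          simp only [hQ', Function.update_self, hn, if_true, k1, k2]
          exact ⟨by rw [add_assoc], trivial⟩
        · simpa [hQ', hnm] using ⟨k1, k2⟩
      of_some := by
        intro n k hn
        obtain ⟨k1, k2⟩ := hQ.of_some (m := n) hn
        exact ⟨(strip_le n).trans k1, by simp only at hA; linarith⟩
      location := by
        intro e he
        rcases List.mem_cons.1 he with rfl | he
        · rcases hk : Q.tag m with _ | n
          · obtain ⟨k1, -⟩ := hQ.of_none hk
            refine Or.inl ⟨m, ?_, h1⟩
            have hs := hQ.shelf_nonneg m
            simp only [shelfRct, hQ', Function.update_self, hk, if_true, Placed.rct, k1]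
            refine ⟨le_rfl, ?_, ?_, ?_⟩ <;> simp only <;> linarith
          · exact Or.inr ⟨n, rct_le.trans (hQ.of_some hk).1⟩
        · rcases hQ.location e he with ⟨n, k1, k2⟩ | h
          · exact Or.inl ⟨n, k1.trans
              ⟨le_rfl, le_rfl, le_rfl, by simpa [shelfRct] using shelf_ge n⟩,
              k2⟩
          · exact Or.inr h
      pos := by
        intro e he
        rcases List.mem_cons.1 he with rfl | he
        · exact ⟨hp1, hp2⟩
        · exact hQ.pos e he
      area := by
        intro J
        have h := hQ.area J
        have hle : ∑ n ∈ J, 2 ^ n * Q'.fill n ≤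
            ∑ n ∈ J, 2 ^ n * Q.fill n + ∑ n ∈ J, if n = m then 2 ^ m * p.2 else 0 := by
          rw [← Finset.sum_add_distrib]
          refine Finset.sum_le_sum fun n _ => ?_
          by_cases hn : n = m
          · subst hn
            simp only [hQ', Function.update_self, if_true]
            linarith
          · simp [hQ', hn]
        have hite : (∑ n ∈ J, if n = m then (2 : ℝ) ^ m * p.2 else 0) ≤ 2 ^ m * p.2 := by
          rw [Finset.sum_ite_eq']
          split_ifs
          · exact le_rfl
          · positivity
        have := mul_le_mul_of_nonneg_right h1.le hp2.le
        simp only at hA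
        change Q.store.area / 4 + _ ≤ _
        linarith }

/-- A piece that is not flat is put in a block of its own. -/
lemma Valid.allocate (hQ : Q.Valid P) {p : Piece} (hp : PiecePos p) {q : ℤ}
    (h1 : p.1 ≤ levelWidth q)
    (h2 : p.2 ≤ levelHeight q) (h3 : 2 ^ q / 4 ≤ p.1 * p.2) :
    ∃ (c : ℝ × ℝ) (Q' : Packer), Q'.Valid ((p, c) :: P) := by
  obtain ⟨D', c, k, hs⟩ := hQ.store.exists_serves q
  obtain ⟨n₀, t, ht, hct⟩ := hs.le_blk
  have rct_le : (Placed.rct (p, c)).Le (block c q) :=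
    ⟨le_rfl, by simpa [Placed.rct, block] using h1, le_rfl,
      by simpa [Placed.rct, block] using h2⟩
  have hA := totalArea_cons (p, c) P
  have hpp := mul_pos hp.1 hp.2
  refine ⟨c, { Q with store := D' }, ?_⟩
  exact
    { store := hs.valid
      fill_nonneg := hQ.fill_nonneg
      shelf_nonneg := hQ.shelf_nonneg
      shelf_le := hQ.shelf_le
      blk_sep_strip := by
        intro n s m hs'
        obtain ⟨u, hu, hle⟩ := hs.blk_le hs'
        exact (hQ.blk_sep_strip m hu).mono hle (Rct.Le.refl _)
      strip_sep := hQ.strip_sep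
      rct_sep_blk := by
        intro e he n s hs'
        rcases List.mem_cons.1 he with rfl | he
        · exact (hs.sep hs').mono rct_le (Rct.Le.refl _)
        · obtain ⟨u, hu, hle⟩ := hs.blk_le hs'
          exact (hQ.rct_sep_blk e he hu).mono (Rct.Le.refl _) hle
      rct_sep_strip := by
        intro e he n
        rcases List.mem_cons.1 he with rfl | he
        · exact (hQ.blk_sep_strip n ht).mono (rct_le.trans hct) (Rct.Le.refl _)
        · exact hQ.rct_sep_strip e he n
      pairwise := List.pairwise_cons.2
        ⟨fun e he => (hQ.rct_sep_blk e he ht).symm.mono (rct_le.trans hct) (Rct.Le.refl _),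
          hQ.pairwise⟩
      of_none := hQ.of_none
      of_some := by
        intro m n hn
        obtain ⟨k1, k2⟩ := hQ.of_some (m := m) hn
        exact ⟨k1.trans (hs.used_le n), by simp only at hA; linarith⟩
      location := by
        intro e he
        rcases List.mem_cons.1 he with rfl | he
        · exact Or.inr ⟨k, rct_le.trans hs.le_used⟩
        · rcases hQ.location e he with h | ⟨n, h⟩
          · exact Or.inl h
          · exact Or.inr ⟨n, h.trans (hs.used_le n)⟩
      pos := by
        intro e he
        rcases List.mem_cons.1 he with rfl | he
        · exact hp
        · exact hQ.pos e he
      area := by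
        intro J
        have h := hQ.area J
        have ha := hs.area
        simp only at hA ⊢
        linarith }

/-- A flat piece that does not fit in the strip of its class starts a new strip. -/
lemma Valid.restart (hQ : Q.Valid P) {p : Piece} (hp : PiecePos p) {m : ℤ} (h1 : 2 ^ m < p.1)
    (h2 : p.1 ≤ 2 * 2 ^ m) (h3 : p.2 ≤ 2 ^ m / 2) (h4 : 2 ^ m < Q.fill m + p.2) :
    ∃ (c : ℝ × ℝ) (Q' : Packer), Q'.Valid ((p, c) :: P) := by
  obtain ⟨D', c, k, hs⟩ := hQ.store.exists_serves (2 * m + 1)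
  obtain ⟨n₀, t, ht, hct⟩ := hs.le_blk
  obtain ⟨hp1, hp2⟩ := hp
  have hm := two_zpow_pos m
  have hblock : block c (2 * m + 1) = ⟨c.1, c.2, 2 * 2 ^ m, 2 ^ m⟩ := by
    rw [block, levelWidth_odd, levelHeight_odd]
  have rct_le : (Placed.rct (p, c)).Le (block c (2 * m + 1)) := by
    rw [hblock]
    refine ⟨le_rfl, ?_, le_rfl, ?_⟩ <;> simp only [Placed.rct] <;> linarith
  have hA := totalArea_cons (p, c) P
  have hpp := mul_pos hp1 hp2
  set Q' : Packer :=
    { store := D'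
      corner := Function.update Q.corner m (c.1, c.2 + p.2)
      fill := Function.update Q.fill m p.2
      shelf := Q.shelf
      tag := Function.update Q.tag m (some k) } with hQ'
  have strip_of_ne : ∀ {n}, n ≠ m → Q'.strip n = Q.strip n := by
    intro n hn
    simp [strip, hQ', hn]
  have strip_self : Q'.strip m = ⟨c.1, c.2 + p.2, 2 * 2 ^ m, 2 ^ m - p.2⟩ := by
    simp [strip, hQ']
  have strip_le : (Q'.strip m).Le (block c (2 * m + 1)) := by
    rw [strip_self, hblock]
    refine ⟨le_rfl, le_rfl, ?_, ?_⟩ <;> simp only <;> linarith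
  refine ⟨c, Q', ?_⟩
  exact
    { store := hs.valid
      fill_nonneg := by
        intro n
        by_cases hn : n = m
        · subst hn
          simpa [hQ'] using hp2.le
        · simpa [hQ', hn] using hQ.fill_nonneg n
      shelf_nonneg := hQ.shelf_nonneg
      shelf_le := hQ.shelf_le
      blk_sep_strip := by
        intro n s m' hs'
        by_cases hn : m' = m
        · subst hn
          exact (hs.sep hs').symm.mono (Rct.Le.refl _) strip_le
        · rw [strip_of_ne hn]
          obtain ⟨u, hu, hle⟩ := hs.blk_le hs'
          exact (hQ.blk_sep_strip m' hu).mono hle (Rct.Le.refl _)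
      strip_sep := by
        have key : ∀ n, n ≠ m → (Q'.strip m).Sep (Q'.strip n) := by
          intro n hn
          rw [strip_of_ne hn]
          exact (hQ.blk_sep_strip n ht).mono (strip_le.trans hct) (Rct.Le.refl _)
        intro n n' hne
        by_cases hn : n = m
        · subst hn
          exact key n' hne.symm
        · by_cases hn' : n' = m
          · subst hn'
            exact (key n hn).symm
          · rw [strip_of_ne hn, strip_of_ne hn']
            exact hQ.strip_sep hne
      rct_sep_blk := by
        intro e he n s hs'
        rcases List.mem_cons.1 he with rfl | he
        · exact (hs.sep hs').mono rct_le (Rct.Le.refl _)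
        · obtain ⟨u, hu, hle⟩ := hs.blk_le hs'
          exact (hQ.rct_sep_blk e he hu).mono (Rct.Le.refl _) hle
      rct_sep_strip := by
        intro e he n
        by_cases hn : n = m
        · subst hn
          rcases List.mem_cons.1 he with rfl | he
          · rw [strip_self]
            exact Or.inr (Or.inr (Or.inl le_rfl))
          · exact (hQ.rct_sep_blk e he ht).mono (Rct.Le.refl _) (strip_le.trans hct)
        · rw [strip_of_ne hn]
          rcases List.mem_cons.1 he with rfl | he
          · exact (hQ.blk_sep_strip n ht).mono (rct_le.trans hct) (Rct.Le.refl _)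
          · exact hQ.rct_sep_strip e he n
      pairwise := List.pairwise_cons.2
        ⟨fun e he => (hQ.rct_sep_blk e he ht).symm.mono (rct_le.trans hct) (Rct.Le.refl _),
          hQ.pairwise⟩
      of_none := by
        intro n hn
        by_cases hnm : n = m
        · subst hnm
          simp [hQ'] at hn
        · have := hQ.of_none (m := n) (by simpa [hQ', hnm] using hn)
          simpa [hQ', hnm] using this
      of_some := by
        intro n i hn
        by_cases hnm : n = m
        · subst hnm
          have hki : k = i := by simpa [hQ'] using hn
          subst hki
          refine ⟨strip_le.trans hs.le_used, ?_⟩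
          have h := hQ.area {n}
          rw [Finset.sum_singleton] at h
          have := hQ.store.area_nonneg
          simp only at hA
          nlinarith
        · obtain ⟨k1, k2⟩ := hQ.of_some (m := n) (n := i) (by simpa [hQ', hnm] using hn)
          rw [strip_of_ne hnm]
          exact ⟨k1.trans (hs.used_le i), by simp only at hA; linarith⟩
      location := by
        intro e he
        rcases List.mem_cons.1 he with rfl | he
        · exact Or.inr ⟨k, rct_le.trans hs.le_used⟩
        · rcases hQ.location e he with h | ⟨n, h⟩
          · exact Or.inl h
          · exact Or.inr ⟨n, h.trans (hs.used_le n)⟩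
      pos := by
        intro e he
        rcases List.mem_cons.1 he with rfl | he
        · exact ⟨hp1, hp2⟩
        · exact hQ.pos e he
      area := by
        intro J
        have h := hQ.area (insert m J)
        rw [← Finset.add_sum_erase _ _ (Finset.mem_insert_self m J),
          Finset.erase_insert_eq_erase] at h
        have ha := hs.area
        rw [two_zpow_succ, two_zpow_two_mul] at ha
        have hnonneg : ∀ n, 0 ≤ (2 : ℝ) ^ n * Q'.fill n := by
          intro n
          by_cases hn : n = m
          · subst hn
            simp only [hQ', Function.update_self]
            positivity
          · simp only [hQ', Function.update_of_ne hn]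
            exact mul_nonneg (two_zpow_pos n).le (hQ.fill_nonneg n)
        have hle : ∑ n ∈ J, 2 ^ n * Q'.fill n ≤
            2 ^ m * p.2 + ∑ n ∈ J.erase m, 2 ^ n * Q.fill n := by
          calc ∑ n ∈ J, 2 ^ n * Q'.fill n ≤ ∑ n ∈ insert m J, 2 ^ n * Q'.fill n :=
                Finset.sum_le_sum_of_subset_of_nonneg (Finset.subset_insert _ _)
                  fun n _ _ => hnonneg n
            _ = 2 ^ m * p.2 + ∑ n ∈ J.erase m, 2 ^ n * Q.fill n := by
                rw [← Finset.add_sum_erase _ _ (Finset.mem_insert_self m J),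
                  Finset.erase_insert_eq_erase]
                congr 1
                · simp [hQ']
                · refine Finset.sum_congr rfl fun n hn => ?_
                  simp [hQ', Finset.ne_of_mem_erase hn]
        have hfill : 2 ^ m / 2 ≤ Q.fill m := by linarith
        have k1 := mul_le_mul_of_nonneg_left hfill hm.le
        have k2 := mul_le_mul_of_nonneg_right h1.le hp2.le
        change D'.area / 4 + _ ≤ _
        simp only at hA
        linarith }

/-- Every further piece can be placed. -/
lemma Valid.exists_cons (hQ : Q.Valid P) {p : Piece} (hp : PiecePos p) (hle : p.2 ≤ p.1) :
    ∃ (c : ℝ × ℝ) (Q' : Packer), Q'.Valid ((p, c) :: P) := by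
  obtain ⟨m, h1, h2⟩ := exists_mem_Ioc_zpow hp.1 (one_lt_two (α := ℝ))
  rw [two_zpow_succ] at h2
  have hm := two_zpow_pos m
  rcases le_or_gt p.2 (2 ^ m / 2) with h3 | h3
  · rcases le_or_gt (Q.fill m + p.2) (2 ^ m) with h4 | h4
    · exact ⟨_, hQ.stack hp h1 h2 h4⟩
    · exact hQ.restart hp h1 h2 h3 h4
  · have e1 := two_zpow_succ (2 * m)
    rw [two_zpow_two_mul] at e1
    rcases le_or_gt p.2 (2 ^ m) with h4 | h4
    · refine hQ.allocate hp (q := 2 * m + 1) (by rwa [levelWidth_odd]) (by rwa [levelHeight_odd]) ?_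
      rw [e1]
      nlinarith
    · refine hQ.allocate hp (q := 2 * (m + 1)) (by rwa [levelWidth_even, two_zpow_succ])
        (by rw [levelHeight_even, two_zpow_succ]; exact hle.trans h2) ?_
      rw [two_zpow_two_mul, two_zpow_succ]
      nlinarith

/-- The placed pieces lie in the box `[0, W] × [0, H]`. -/
def InBox (P : List Placed) (W H : ℝ) : Prop :=
  ∀ e ∈ P, 0 ≤ e.2.1 ∧ e.2.1 + e.1.1 ≤ W ∧ 0 ≤ e.2.2 ∧ e.2.2 + e.1.2 ≤ H

/-- If the last region in use is the shelf of class `m`, the bounding box is small. -/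
lemma Valid.exists_box_of_shelf (hQ : Q.Valid P) {m : ℤ} {e₀ : Placed} (he₀ : e₀ ∈ P)
    (hm : 2 ^ m < e₀.1.1)
    (hloc : ∀ e ∈ P, (∃ n ≤ m, e.rct.Le (Q.shelfRct n)) ∨ ∃ n ≤ m, e.rct.Le (Q.store.used n)) :
    ∃ W H : ℝ, InBox P W H ∧ ∀ X : ℝ, 0 < X → 4 * totalArea P ≤ X ^ 2 →
      (∀ e ∈ P, e.1.1 ≤ X) → W + H ≤ 99 / 25 * X := by
  have hu := two_zpow_pos m
  have hshelf := hQ.shelf_nonneg m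
  have hshelf' := hQ.shelf_le m
  refine ⟨2 * 2 ^ m, 2 ^ m + Q.shelf m, ?_, ?_⟩
  · intro e he
    rcases hloc e he with ⟨n, hn, h1, h2, h3, h4⟩ | ⟨n, hn, h1, h2, h3, h4⟩
    · simp only [shelfRct, Placed.rct] at h1 h2 h3 h4
      have := two_zpow_le hn
      have := two_zpow_pos n
      refine ⟨h1, by linarith, by linarith, ?_⟩
      rcases hn.lt_or_eq with hlt | rfl
      · have := two_zpow_le (show n + 1 ≤ m from hlt)
        rw [two_zpow_succ] at this
        linarith [hQ.shelf_le n]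
      · exact h4
    · obtain ⟨k1, k2⟩ := hQ.store.ext_bounds n
      simp only [Store.used, Placed.rct] at h1 h2 h3 h4
      have := two_zpow_le hn
      have := two_zpow_pos n
      exact ⟨by linarith, by linarith, h3, by linarith⟩
  · intro X hX hA hlen
    have hXm := hm.trans_le (hlen _ he₀)
    rcases le_or_gt (Q.shelf m) (2 ^ m / 2) with h | h
    · linarith
    · have key : 2 * (2 ^ m * 2 ^ m) ≤ X ^ 2 := by
        rcases hk : Q.tag m with _ | n
        · have h1 := hQ.area {m}
          rw [Finset.sum_singleton, (hQ.of_none hk).2] at h1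
          have := hQ.store.area_nonneg
          nlinarith
        · have := (hQ.of_some hk).2
          nlinarith
      nlinarith

/-- If the last region in use is home `m`, the bounding box is small. -/
lemma Valid.exists_box_of_home (hQ : Q.Valid P) {m : ℤ} {e₀ : Placed} (he₀ : e₀ ∈ P)
    (hm : e₀.rct.Le (Q.store.used m))
    (hloc : ∀ e ∈ P, (∃ n < m, e.rct.Le (Q.shelfRct n)) ∨ ∃ n ≤ m, e.rct.Le (Q.store.used n)) :
    ∃ W H : ℝ, InBox P W H ∧ ∀ X : ℝ, 0 < X → 4 * totalArea P ≤ X ^ 2 →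
      (∀ e ∈ P, e.1.1 ≤ X) → W + H ≤ 99 / 25 * X := by
  have hu := two_zpow_pos m
  have hf := hQ.shelf_nonneg (m - 1)
  have hf' := hQ.shelf_le (m - 1)
  set f := Q.shelf (m - 1) with hfdef
  rw [two_zpow_pred] at hf'
  have inBox : ∀ {W H : ℝ}, 2 ^ m ≤ W → 2 ^ m / 2 + f ≤ H → 2 ^ m + (Q.store.ext m).1 ≤ W →
      (Q.store.ext m).2 ≤ H → InBox P W H := by
    intro W H h1 h2 h3 h4 e he
    rcases hloc e he with ⟨n, hn, k1, k2, k3, k4⟩ | ⟨n, hn, k1, k2, k3, k4⟩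
    · simp only [shelfRct, Placed.rct] at k1 k2 k3 k4
      have hn' := two_zpow_le (show n + 1 ≤ m from hn)
      rw [two_zpow_succ] at hn'
      have := two_zpow_pos n
      refine ⟨k1, by linarith, by linarith, ?_⟩
      rcases (show n ≤ m - 1 by omega).lt_or_eq with hlt | rfl
      · have := two_zpow_le (show n + 1 ≤ m - 1 by omega)
        rw [two_zpow_succ, two_zpow_pred] at this
        linarith [hQ.shelf_le n]
      · rw [two_zpow_pred] at k4
        exact k4.trans h2
    · simp only [Store.used, Placed.rct] at k1 k2 k3 k4
      have := two_zpow_pos n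
      rcases hn.lt_or_eq with hlt | rfl
      · have := two_zpow_le (show n + 1 ≤ m from hlt)
        rw [two_zpow_succ] at this
        obtain ⟨l1, l2⟩ := hQ.store.ext_bounds n
        exact ⟨by linarith, by linarith, k3, by linarith⟩
      · exact ⟨by linarith, by linarith, k3, by linarith⟩
  have hstore : Q.store.area / 4 ≤ totalArea P := by simpa using hQ.area ∅
  have htall : 2 ^ m / 4 < f →
      2 ^ m * 2 ^ m ≤ 4 * totalArea P ∨
        Q.store.area + 2 ^ m * 2 ^ m / 2 ≤ 4 * totalArea P := by
    intro h
    rcases hk : Q.tag (m - 1) with _ | n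
    · have h1 := hQ.area {m - 1}
      rw [Finset.sum_singleton, (hQ.of_none hk).2, two_zpow_pred, ← hfdef] at h1
      right
      nlinarith
    · have := (hQ.of_some hk).2
      rw [two_zpow_pred] at this
      left
      linarith
  have le_of_sq : ∀ {b X : ℝ}, 0 < X → b ^ 2 ≤ (99 / 25 * X) ^ 2 → b ≤ 99 / 25 * X :=
    fun hX h => (abs_le_of_sq_le_sq' h (by positivity)).2
  cases hQ.store.stage m with
  | untouched _ _ h =>
    obtain ⟨h1, h2, -, -⟩ := hm
    have := (hQ.pos _ he₀).1
    simp only [Store.used, Placed.rct, h] at h1 h2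
    linarith
  | quarter _ _ _ _ h hA =>
    refine ⟨3 / 2 * 2 ^ m, 2 ^ m / 2 + f, inBox ?_ le_rfl ?_ ?_, fun X hX hX' _ => ?_⟩
    · linarith
    · rw [h]; simp only; linarith
    · rw [h]; simp only; linarith
    · refine le_of_sq hX ?_
      rcases le_or_gt f (2 ^ m / 4) with hlt | hlt
      · nlinarith
      · rcases htall hlt with h' | h' <;> nlinarith
  | half _ h hA =>
    refine ⟨2 * 2 ^ m, 2 ^ m / 2 + f, inBox ?_ le_rfl ?_ ?_, fun X hX hX' _ => ?_⟩
    · linarith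
    · rw [h]; simp only; linarith
    · rw [h]; simp only; linarith
    · refine le_of_sq hX ?_
      rcases le_or_gt f (2 ^ m / 4) with hlt | hlt
      · nlinarith
      · rcases htall hlt with h' | h' <;> nlinarith
  | crowded h hA =>
    refine ⟨2 * 2 ^ m, 2 ^ m, inBox ?_ ?_ ?_ ?_, fun X hX hX' _ => ?_⟩
    · linarith
    · linarith
    · rw [h]; simp only; linarith
    · rw [h]
    · refine le_of_sq hX ?_
      nlinarith

/-- The bounding box of the online packing is small. -/
lemma Valid.exists_box (hQ : Q.Valid P) (hP : P ≠ []) :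
    ∃ W H : ℝ, InBox P W H ∧ ∀ X : ℝ, 0 < X → 4 * totalArea P ≤ X ^ 2 →
      (∀ e ∈ P, e.1.1 ≤ X) → W + H ≤ 99 / 25 * X := by
  have hrank : ∀ e : P.toFinset, ∃ r : ℤ,
      (∃ m, r = 2 * m + 1 ∧ e.1.rct.Le (Q.shelfRct m) ∧ 2 ^ m < e.1.1.1) ∨
        ∃ m, r = 2 * m ∧ e.1.rct.Le (Q.store.used m) := by
    intro e
    rcases hQ.location _ (List.mem_toFinset.1 e.2) with ⟨m, h⟩ | ⟨m, h⟩
    · exact ⟨_, Or.inl ⟨m, rfl, h⟩⟩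
    · exact ⟨_, Or.inr ⟨m, rfl, h⟩⟩
  choose r hr using hrank
  obtain ⟨a, ha⟩ := List.exists_mem_of_ne_nil P hP
  have : Nonempty P.toFinset := ⟨⟨a, List.mem_toFinset.2 ha⟩⟩
  obtain ⟨e₀, he₀⟩ := Finite.exists_max r
  have he₀P := List.mem_toFinset.1 e₀.2
  rcases hr e₀ with ⟨m, hm, h1, h2⟩ | ⟨m, hm, h1⟩
  · refine hQ.exists_box_of_shelf he₀P h2 fun e he => ?_
    have hle := he₀ ⟨e, List.mem_toFinset.2 he⟩
    rcases hr ⟨e, List.mem_toFinset.2 he⟩ with ⟨n, hn, h, -⟩ | ⟨n, hn, h⟩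
    · exact Or.inl ⟨n, by omega, h⟩
    · exact Or.inr ⟨n, by omega, h⟩
  · refine hQ.exists_box_of_home he₀P h1 fun e he => ?_
    have hle := he₀ ⟨e, List.mem_toFinset.2 he⟩
    rcases hr ⟨e, List.mem_toFinset.2 he⟩ with ⟨n, hn, h, -⟩ | ⟨n, hn, h⟩
    · exact Or.inl ⟨n, by omega, h⟩
    · exact Or.inr ⟨n, by omega, h⟩

end Packer

/-! ### Lower bounds for the bounding box of a packing -/

section BoundingBox

variable {S : Set (ℝ × ℝ)}

lemma subset_boundingBox (hS : Bornology.IsBounded S) :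
    S ⊆ Icc (sInf (Prod.fst '' S)) (sSup (Prod.fst '' S)) ×ˢ
      Icc (sInf (Prod.snd '' S)) (sSup (Prod.snd '' S)) := by
  intro z hz
  have h1 := hS.image_fst
  have h2 := hS.image_snd
  exact ⟨⟨csInf_le h1.bddBelow (mem_image_of_mem _ hz),
      le_csSup h1.bddAbove (mem_image_of_mem _ hz)⟩,
    ⟨csInf_le h2.bddBelow (mem_image_of_mem _ hz), le_csSup h2.bddAbove (mem_image_of_mem _ hz)⟩⟩

lemma boxWidth_le {W H : ℝ} (hne : S.Nonempty) (h : S ⊆ Icc 0 W ×ˢ Icc 0 H) : boxWidth S ≤ W := by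
  have h1 : sSup (Prod.fst '' S) ≤ W :=
    csSup_le (hne.image _) (by rintro _ ⟨z, hz, rfl⟩; exact (h hz).1.2)
  have h2 : 0 ≤ sInf (Prod.fst '' S) :=
    le_csInf (hne.image _) (by rintro _ ⟨z, hz, rfl⟩; exact (h hz).1.1)
  rw [boxWidth]; linarith

lemma boxHeight_le {W H : ℝ} (hne : S.Nonempty) (h : S ⊆ Icc 0 W ×ˢ Icc 0 H) :
    boxHeight S ≤ H := by
  have h1 : sSup (Prod.snd '' S) ≤ H :=
    csSup_le (hne.image _) (by rintro _ ⟨z, hz, rfl⟩; exact (h hz).2.2)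
  have h2 : 0 ≤ sInf (Prod.snd '' S) :=
    le_csInf (hne.image _) (by rintro _ ⟨z, hz, rfl⟩; exact (h hz).2.1)
  rw [boxHeight]; linarith

lemma le_box_of_placedRect_subset (hS : Bornology.IsBounded S) {p : Piece} (hp : PiecePos p)
    {c : ℝ × ℝ} (h : placedRect p c ⊆ S) : p.1 ≤ boxWidth S ∧ p.2 ≤ boxHeight S := by
  obtain ⟨hp1, hp2⟩ := hp
  have h1 := subset_boundingBox hS (h (show c ∈ placedRect p c from
    ⟨⟨le_rfl, by linarith⟩, ⟨le_rfl, by linarith⟩⟩))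
  have h2 := subset_boundingBox hS (h (show (c.1 + p.1, c.2 + p.2) ∈ placedRect p c from
    ⟨⟨by simp only; linarith, le_rfl⟩, ⟨by simp only; linarith, le_rfl⟩⟩))
  have k1 := h1.1.1
  have k2 := h1.2.1
  have k3 := h2.1.2
  have k4 := h2.2.2
  simp only at k3 k4
  rw [boxWidth, boxHeight]
  constructor <;> linarith

end BoundingBox

lemma interior_placedRect (p : Piece) (c : ℝ × ℝ) :
    interior (placedRect p c) = Ioo c.1 (c.1 + p.1) ×ˢ Ioo c.2 (c.2 + p.2) := by
  rw [placedRect, interior_prod_eq, interior_Icc, interior_Icc]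

lemma disjoint_interior_of_sep {e e' : Placed} (h : e.rct.Sep e'.rct) :
    Disjoint (interior (placedRect e.1 e.2)) (interior (placedRect e'.1 e'.2)) := by
  rw [interior_placedRect, interior_placedRect, Set.disjoint_left]
  rintro z ⟨⟨a1, a2⟩, a3, a4⟩ ⟨⟨b1, b2⟩, b3, b4⟩
  simp only [Rct.Sep, Placed.rct] at h
  rcases h with h | h | h | h <;> linarith

section Packing

variable {ι : Type*} [Fintype ι] {p : ι → Piece} {c : ι → ℝ × ℝ}

lemma isBounded_iUnion_placedRect (p : ι → Piece) (c : ι → ℝ × ℝ) :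
    Bornology.IsBounded (⋃ i, placedRect (p i) (c i)) :=
  (isCompact_iUnion fun _ => isCompact_Icc.prod isCompact_Icc).isBounded

/-- The pieces of a packing have at most the area of the bounding box. -/
lemma sum_area_le (hp : ∀ i, PiecePos (p i))
    (hd : ∀ i j, i ≠ j →
      Disjoint (interior (placedRect (p i) (c i))) (interior (placedRect (p j) (c j))))
    (h0 : 0 ≤ boxWidth (⋃ i, placedRect (p i) (c i))) :
    ∑ i, (p i).1 * (p i).2 ≤
      boxWidth (⋃ i, placedRect (p i) (c i)) * boxHeight (⋃ i, placedRect (p i) (c i)) := by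
  set S := ⋃ i, placedRect (p i) (c i) with hS
  by_cases hι : Nonempty ι
  swap
  · have : IsEmpty ι := not_nonempty_iff.1 hι
    simp [hS, boxWidth]
  have hsub := subset_boundingBox (isBounded_iUnion_placedRect p c)
  have hH : 0 ≤ boxHeight S := (hp hι.some).2.le.trans
    (le_box_of_placedRect_subset (isBounded_iUnion_placedRect p c) (hp _)
      (subset_iUnion (fun i => placedRect (p i) (c i)) hι.some)).2
  have hvol : ∀ i, MeasureTheory.volume (interior (placedRect (p i) (c i))) =
      ENNReal.ofReal ((p i).1 * (p i).2) := by
    intro i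
    rw [interior_placedRect, MeasureTheory.Measure.volume_eq_prod,
      MeasureTheory.Measure.prod_prod, Real.volume_Ioo, Real.volume_Ioo, add_sub_cancel_left,
      add_sub_cancel_left, ENNReal.ofReal_mul (hp i).1.le]
  have hle : MeasureTheory.volume (⋃ i, interior (placedRect (p i) (c i))) ≤
      ENNReal.ofReal (boxWidth S * boxHeight S) := by
    refine (MeasureTheory.measure_mono
      ((iUnion_mono fun i => interior_subset).trans hsub)).trans ?_
    rw [MeasureTheory.Measure.volume_eq_prod, MeasureTheory.Measure.prod_prod, Real.volume_Icc,
      Real.volume_Icc, ENNReal.ofReal_mul h0]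
    rfl
  rw [MeasureTheory.measure_iUnion hd fun i => isOpen_interior.measurableSet, tsum_fintype,
    Finset.sum_congr rfl fun i _ => hvol i,
    ← ENNReal.ofReal_sum_of_nonneg fun i _ => (mul_pos (hp i).1 (hp i).2).le] at hle
  exact (ENNReal.ofReal_le_ofReal_iff (mul_nonneg h0 hH)).1 hle

end Packing

lemma piecePos_orient {p : Piece} (hp : PiecePos p) (r : Bool) : PiecePos (orient p r) := by
  cases r
  · exact hp
  · exact hp.symm

lemma orient_area (p : Piece) (r : Bool) : (orient p r).1 * (orient p r).2 = p.1 * p.2 := by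
  cases r
  · rfl
  · exact mul_comm _ _

/-- Half of the perimeter of a packing is at least every edge length and at least twice the root of
the total area. -/
lemma le_half_periRotCost {L : List Piece} (hL : L ≠ []) (hpos : ∀ p ∈ L, PiecePos p)
    {pos : Fin L.length → ℝ × ℝ} {rot : Fin L.length → Bool} (h : IsRotPacking L pos rot) :
    4 * (L.map fun p => p.1 * p.2).sum ≤ (periRotCost L pos rot / 2) ^ 2 ∧
      ∀ p ∈ L, p.1 ≤ periRotCost L pos rot / 2 ∧ p.2 ≤ periRotCost L pos rot / 2 := by
  have hq : ∀ i, PiecePos (orient (L.get i) (rot i)) := fun i =>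
    piecePos_orient (hpos _ (List.get_mem L i)) _
  have hbd : Bornology.IsBounded (packedRotSet L pos rot) := isBounded_iUnion_placedRect _ _
  have hle : ∀ i, (orient (L.get i) (rot i)).1 ≤ boxWidth (packedRotSet L pos rot) ∧
      (orient (L.get i) (rot i)).2 ≤ boxHeight (packedRotSet L pos rot) := fun i =>
    le_box_of_placedRect_subset hbd (hq i)
      (subset_iUnion (fun i => placedRect (orient (L.get i) (rot i)) (pos i)) i)
  have hperi : periRotCost L pos rot / 2 =
      boxWidth (packedRotSet L pos rot) + boxHeight (packedRotSet L pos rot) := by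
    rw [periRotCost]; ring
  have hlen : 0 < L.length := List.length_pos_iff.2 hL
  have hW := (hq ⟨0, hlen⟩).1.le.trans (hle ⟨0, hlen⟩).1
  have hH := (hq ⟨0, hlen⟩).2.le.trans (hle ⟨0, hlen⟩).2
  rw [hperi]
  constructor
  · have hA := sum_area_le hq h hW
    simp only [orient_area] at hA
    have hsum : ∑ i, (L.get i).1 * (L.get i).2 = (L.map fun p => p.1 * p.2).sum := by
      conv_rhs => rw [← List.ofFn_get L, List.map_ofFn, List.sum_ofFn]
      rfl
    rw [hsum] at hA
    change _ ≤ boxWidth (packedRotSet L pos rot) * boxHeight (packedRotSet L pos rot) at hA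
    nlinarith [sq_nonneg (boxWidth (packedRotSet L pos rot) - boxHeight (packedRotSet L pos rot))]
  · intro p hp
    obtain ⟨i, rfl⟩ := List.get_of_mem hp
    have h1 := hle i
    cases hr : rot i <;> simp only [hr, orient, if_true, Bool.false_eq_true, if_false] at h1 <;>
      constructor <;> linarith

/-! ### The online strategy -/

/-- Whether the piece has to be rotated so that it is at least as wide as high. -/
noncomputable def isTall (p : Piece) : Bool := decide (p.1 < p.2)

/-- The piece rotated so that it is at least as wide as high. -/
noncomputable def flatten (p : Piece) : Piece := orient p (isTall p)

lemma flatten_snd_le (p : Piece) : (flatten p).2 ≤ (flatten p).1 := by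
  by_cases h : p.1 < p.2
  · simpa [flatten, orient, isTall, h] using h.le
  · rw [flatten, isTall, decide_eq_false h]
    exact not_lt.1 h

lemma flatten_fst (p : Piece) : (flatten p).1 = p.1 ∨ (flatten p).1 = p.2 := by
  unfold flatten orient
  split_ifs <;> simp

/-- The placement of the pieces of a stream, the last piece first. -/
noncomputable def placements : List Piece → List Placed
  | [] => []
  | p :: R =>
    (flatten p, Classical.epsilon fun c =>
      ∃ Q : Packer, Q.Valid ((flatten p, c) :: placements R)) :: placements R

lemma exists_valid_placements (R : List Piece) (hR : ∀ p ∈ R, PiecePos p) :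
    ∃ Q : Packer, Q.Valid (placements R) := by
  induction R with
  | nil => exact ⟨_, Packer.init_valid⟩
  | cons p R ih =>
    obtain ⟨Q, hQ⟩ := ih fun p hp => hR p (List.mem_cons_of_mem _ hp)
    exact Classical.epsilon_spec
      (hQ.exists_cons (piecePos_orient (hR p List.mem_cons_self) _) (flatten_snd_le p))

lemma totalArea_placements (R : List Piece) :
    totalArea (placements R) = (R.map fun p => p.1 * p.2).sum := by
  induction R with
  | nil => rfl
  | cons p R ih =>
    rw [placements, totalArea_cons, ih, List.map_cons, List.sum_cons]
    congr 1
    exact orient_area _ _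

lemma exists_of_mem_placements {R : List Piece} {e : Placed} (he : e ∈ placements R) :
    ∃ p ∈ R, e.1 = flatten p := by
  induction R with
  | nil => simp [placements] at he
  | cons p R ih =>
    rcases List.mem_cons.1 he with rfl | he
    · exact ⟨p, List.mem_cons_self, rfl⟩
    · obtain ⟨q, hq, h⟩ := ih he
      exact ⟨q, List.mem_cons_of_mem _ hq, h⟩

/-- The online strategy. -/
noncomputable def strategy (L : List Piece) : (ℝ × ℝ) × Bool :=
  ((placements L.reverse).head?.elim 0 Prod.snd, L.getLast?.elim false isTall)

/-- The placement of piece `i` by the online strategy. -/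
noncomputable def placedPiece (L : List Piece) (i : Fin L.length) : Placed :=
  (orient (L.get i) (onlineRot strategy L i), onlineRotPos strategy L i)

lemma placements_take_succ (L : List Piece) (i : Fin L.length) :
    placements (L.take (i + 1)).reverse = placedPiece L i :: placements (L.take i).reverse := by
  have htake : L.take (i + 1) = L.take i ++ [L.get i] := List.take_succ_eq_append_getElem i.2
  have hrev : (L.take (i + 1)).reverse = L.get i :: (L.take i).reverse := by
    rw [htake, List.reverse_append]; rfl
  have hrot : onlineRot strategy L i = isTall (L.get i) := by
    rw [onlineRot, strategy, htake, List.getLast?_append]; rfl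
  rw [placedPiece, hrot, onlineRotPos, strategy, hrev]
  rfl

lemma placedPiece_mem {L : List Piece} {i : Fin L.length} {n : ℕ} (h : (i : ℕ) < n)
    (hn : n ≤ L.length) : placedPiece L i ∈ placements (L.take n).reverse := by
  induction n, h using Nat.le_induction with
  | base => rw [Nat.succ_eq_add_one, placements_take_succ]; exact List.mem_cons_self
  | succ n h ih =>
    rw [placements_take_succ L ⟨n, hn⟩]
    exact List.mem_cons_of_mem _ (ih (Nat.le_of_succ_le hn))

lemma placedPiece_sep {L : List Piece} (hpos : ∀ p ∈ L, PiecePos p) {i j : Fin L.length}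
    (h : i < j) : (placedPiece L j).rct.Sep (placedPiece L i).rct := by
  obtain ⟨Q, hQ⟩ := exists_valid_placements (L.take (j + 1)).reverse fun p hp =>
    hpos p (List.mem_of_mem_take (List.mem_reverse.1 hp))
  rw [placements_take_succ] at hQ
  exact (List.pairwise_cons.1 hQ.pairwise).1 _ (placedPiece_mem h j.2.le)

lemma strategy_valid : RotStrategyValid strategy := by
  intro L hpos i j hij
  have hsep : (placedPiece L i).rct.Sep (placedPiece L j).rct := by
    rcases lt_or_gt_of_ne hij with h | h
    · exact (placedPiece_sep hpos h).symm
    · exact placedPiece_sep hpos h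
  simpa only [placedPiece] using disjoint_interior_of_sep hsep

lemma algRotPeri_strategy_le {L : List Piece} (hL : L ≠ []) (hpos : ∀ p ∈ L, PiecePos p)
    {pos : Fin L.length → ℝ × ℝ} {rot : Fin L.length → Bool} (h : IsRotPacking L pos rot) :
    algRotPeri strategy L ≤ 99 / 25 * periRotCost L pos rot := by
  obtain ⟨Q, hQ⟩ := exists_valid_placements L.reverse fun p hp =>
    hpos p (List.mem_reverse.1 hp)
  have hmem : ∀ i, placedPiece L i ∈ placements L.reverse := by
    intro i
    simpa using placedPiece_mem i.2 le_rfl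
  have hlen : 0 < L.length := List.length_pos_iff.2 hL
  obtain ⟨W, H, hbox, hWH⟩ := hQ.exists_box (List.ne_nil_of_mem (hmem ⟨0, hlen⟩))
  obtain ⟨hA, hX⟩ := le_half_periRotCost hL hpos h
  have hX0 : 0 < periRotCost L pos rot / 2 :=
    (hpos _ (List.get_mem L ⟨0, hlen⟩)).1.trans_le (hX _ (List.get_mem L ⟨0, hlen⟩)).1
  have hle := hWH _ hX0 (by simpa [totalArea_placements, List.sum_reverse] using hA) (by
    intro e he
    obtain ⟨p, hp, hep⟩ := exists_of_mem_placements he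
    have := hX p (List.mem_reverse.1 hp)
    rw [hep]
    rcases flatten_fst p with h | h <;> rw [h]
    exacts [this.1, this.2])
  set S := packedRotSet L (onlineRotPos strategy L) (onlineRot strategy L) with hS
  have hsub : S ⊆ Icc 0 W ×ˢ Icc 0 H := by
    refine iUnion_subset fun i => ?_
    obtain ⟨h1, h2, h3, h4⟩ := hbox _ (hmem i)
    exact prod_mono (Icc_subset_Icc h1 h2) (Icc_subset_Icc h3 h4)
  have hne : S.Nonempty := by
    have hp := piecePos_orient (hpos _ (List.get_mem L ⟨0, hlen⟩)) (onlineRot strategy L ⟨0, hlen⟩)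
    refine ⟨onlineRotPos strategy L ⟨0, hlen⟩, mem_iUnion.2 ⟨⟨0, hlen⟩, ?_⟩⟩
    exact ⟨⟨le_rfl, by linarith [hp.1]⟩, ⟨le_rfl, by linarith [hp.2]⟩⟩
  have h1 := boxWidth_le hne hsub
  have h2 := boxHeight_le hne hsub
  rw [algRotPeri, periRotCost, ← hS]
  linarith

end OnlinePacking

/-- There exist a real constant `c < 4` and a valid online
rotation strategy `σ` such that for every nonempty finite stream `L` of
pieces, `ALG_σ(L) ≤ c * OPT(L)` (perimeter of the bounding box, rotations by
90° allowed). -/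
theorem perimeter_rotation_upper_bound :
    ∃ c : ℝ, c < 4 ∧ ∃ σ : List Piece → (ℝ × ℝ) × Bool, RotStrategyValid σ ∧
      ∀ L : List Piece, L ≠ [] → (∀ p ∈ L, PiecePos p) →
        algRotPeri σ L ≤ c * optRotPeri L := by
  refine ⟨99 / 25, by norm_num, OnlinePacking.strategy, OnlinePacking.strategy_valid,
    fun L hL hpos => ?_⟩
  rw [← div_le_iff₀' (by norm_num)]
  refine le_csInf ⟨_, _, _, OnlinePacking.strategy_valid L hpos, rfl⟩ ?_
  rintro _ ⟨pos, rot, h, rfl⟩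
  rw [div_le_iff₀' (by norm_num)]
  exact OnlinePacking.algRotPeri_strategy_le hL hpos h
end

section
/- For every valid online translation strategy σ and every ε > 0, there exists a nonempty finite stream L of pieces such that ALG_σ(L) ≥ (4/3 − ε)·OPT(L). (Lower bound of 4/3 on the competitive ratio of any online algorithm for perimeter minimization with translations only.) -/
open Set

theorem disjoint_interior_placedRect_iff (p p' : Piece) (q q' : ℝ × ℝ) :
    Disjoint (interior (placedRect p q)) (interior (placedRect p' q')) ↔
      min (q.1 + p.1) (q'.1 + p'.1) ≤ max q.1 q'.1 ∨
      min (q.2 + p.2) (q'.2 + p'.2) ≤ max q.2 q'.2 := by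
  simp only [placedRect, interior_prod_eq, interior_Icc, Set.disjoint_prod,
    Set.Ioo_disjoint_Ioo]

theorem isBounded_packedSet (L : List Piece) (pos : Fin L.length → ℝ × ℝ) :
    Bornology.IsBounded (packedSet L pos) :=
  (Bornology.isBounded_iUnion).2 fun _ =>
    (isCompact_Icc.prod isCompact_Icc).isBounded

/-- The horizontal extent of each placed piece lies in that of the bounding box. -/
theorem placedRect_fst_bounds {L : List Piece} (hL : ∀ p ∈ L, PiecePos p)
    (pos : Fin L.length → ℝ × ℝ) (i : Fin L.length) :
    sInf (Prod.fst '' packedSet L pos) ≤ (pos i).1 ∧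
      (pos i).1 + (L.get i).1 ≤ sSup (Prod.fst '' packedSet L pos) := by
  have hb := (isBounded_packedSet L pos).image_fst
  obtain ⟨h1, h2⟩ := hL _ (L.get_mem i)
  constructor
  · refine csInf_le hb.bddBelow ⟨pos i, Set.mem_iUnion.2 ⟨i, ?_⟩, rfl⟩
    simp only [placedRect, Set.mem_prod, Set.mem_Icc]
    grind
  · refine le_csSup hb.bddAbove
      ⟨((pos i).1 + (L.get i).1, (pos i).2), Set.mem_iUnion.2 ⟨i, ?_⟩, rfl⟩
    simp only [placedRect, Set.mem_prod, Set.mem_Icc]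
    grind

/-- The vertical extent of each placed piece lies in that of the bounding box. -/
theorem placedRect_snd_bounds {L : List Piece} (hL : ∀ p ∈ L, PiecePos p)
    (pos : Fin L.length → ℝ × ℝ) (i : Fin L.length) :
    sInf (Prod.snd '' packedSet L pos) ≤ (pos i).2 ∧
      (pos i).2 + (L.get i).2 ≤ sSup (Prod.snd '' packedSet L pos) := by
  have hb := (isBounded_packedSet L pos).image_snd
  obtain ⟨h1, h2⟩ := hL _ (L.get_mem i)
  constructor
  · refine csInf_le hb.bddBelow ⟨pos i, Set.mem_iUnion.2 ⟨i, ?_⟩, rfl⟩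
    simp only [placedRect, Set.mem_prod, Set.mem_Icc]
    grind
  · refine le_csSup hb.bddAbove
      ⟨((pos i).1, (pos i).2 + (L.get i).2), Set.mem_iUnion.2 ⟨i, ?_⟩, rfl⟩
    simp only [placedRect, Set.mem_prod, Set.mem_Icc]
    grind

theorem periCost_nonneg (L : List Piece) (pos : Fin L.length → ℝ × ℝ) :
    0 ≤ periCost L pos := by
  have hb1 := (isBounded_packedSet L pos).image_fst
  have hb2 := (isBounded_packedSet L pos).image_snd
  have h1 := Real.sInf_le_sSup _ hb1.bddBelow hb1.bddAbove
  have h2 := Real.sInf_le_sSup _ hb2.bddBelow hb2.bddAbove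
  simp only [periCost, boxWidth, boxHeight]
  linarith

theorem optPeri_nonneg (L : List Piece) : 0 ≤ optPeri L := by
  refine Real.sInf_nonneg ?_
  rintro _ ⟨pos, -, rfl⟩
  exact periCost_nonneg L pos

/-- A packing inside the box `[0,A] × [0,B]` bounds the optimal perimeter. -/
theorem optPeri_le_of_packing {L : List Piece} (hne : L ≠ []) (hL : ∀ p ∈ L, PiecePos p)
    {pos : Fin L.length → ℝ × ℝ} (hpos : IsPacking L pos) {A B : ℝ}
    (h1 : ∀ i, 0 ≤ (pos i).1 ∧ (pos i).1 + (L.get i).1 ≤ A)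
    (h2 : ∀ i, 0 ≤ (pos i).2 ∧ (pos i).2 + (L.get i).2 ≤ B) :
    optPeri L ≤ 2 * (A + B) := by
  have hle : optPeri L ≤ periCost L pos := by
    refine csInf_le ⟨0, ?_⟩ ⟨pos, hpos, rfl⟩
    rintro _ ⟨pos', -, rfl⟩
    exact periCost_nonneg L pos'
  refine hle.trans ?_
  have hS : (packedSet L pos).Nonempty := by
    let i : Fin L.length := ⟨0, List.length_pos_iff.2 hne⟩
    obtain ⟨hp1, hp2⟩ := hL _ (L.get_mem i)
    refine ⟨pos i, Set.mem_iUnion.2 ⟨i, ?_⟩⟩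
    simp only [placedRect, Set.mem_prod, Set.mem_Icc]
    grind
  have hmem : ∀ z ∈ packedSet L pos, (0 ≤ z.1 ∧ z.1 ≤ A) ∧ (0 ≤ z.2 ∧ z.2 ≤ B) := by
    intro z hz
    obtain ⟨i, hi⟩ := Set.mem_iUnion.1 hz
    simp only [placedRect, Set.mem_prod, Set.mem_Icc] at hi
    have := h1 i
    have := h2 i
    grind
  have a1 : sSup (Prod.fst '' packedSet L pos) ≤ A :=
    csSup_le (hS.image _) (by rintro _ ⟨z, hz, rfl⟩; exact (hmem z hz).1.2)
  have a2 : 0 ≤ sInf (Prod.fst '' packedSet L pos) :=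
    le_csInf (hS.image _) (by rintro _ ⟨z, hz, rfl⟩; exact (hmem z hz).1.1)
  have a3 : sSup (Prod.snd '' packedSet L pos) ≤ B :=
    csSup_le (hS.image _) (by rintro _ ⟨z, hz, rfl⟩; exact (hmem z hz).2.2)
  have a4 : 0 ≤ sInf (Prod.snd '' packedSet L pos) :=
    le_csInf (hS.image _) (by rintro _ ⟨z, hz, rfl⟩; exact (hmem z hz).2.1)
  simp only [periCost, boxWidth, boxHeight]
  linarith

/-- Pairwise `d`-separated intervals of length `d` inside `[a,b]` have total length at
most `b - a`. -/
theorem card_mul_le_of_separated {ι : Type*} [DecidableEq ι] (s : Finset ι) (f : ι → ℝ)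
    (d a : ℝ) (hsep : ∀ i ∈ s, ∀ j ∈ s, i ≠ j → d ≤ |f i - f j|) (ha : ∀ i ∈ s, a ≤ f i)
    (b : ℝ) (hab : a ≤ b) (hb : ∀ i ∈ s, f i + d ≤ b) :
    (s.card : ℝ) * d ≤ b - a := by
  induction s using Finset.induction_on_max_value f generalizing b with
  | empty => simpa using hab
  | insert m s hm hmax ih =>
    have hle := ih
      (fun i hi j hj => hsep i (Finset.mem_insert_of_mem hi) j (Finset.mem_insert_of_mem hj))
      (fun i hi => ha i (Finset.mem_insert_of_mem hi)) (f m)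
      (ha m (Finset.mem_insert_self _ _))
      (fun i hi => by
        have h1 := hsep m (Finset.mem_insert_self _ _) i (Finset.mem_insert_of_mem hi)
          (by rintro rfl; exact hm hi)
        rw [abs_of_nonneg (sub_nonneg.2 (hmax i hi))] at h1
        linarith)
    have := hb m (Finset.mem_insert_self _ _)
    rw [Finset.card_insert_of_notMem hm]
    push_cast
    linarith

/-- Copies of the same piece with disjoint interiors are separated in one direction. -/
theorem separated_of_disjoint (p : Piece) (q q' : ℝ × ℝ)
    (h : Disjoint (interior (placedRect p q)) (interior (placedRect p q'))) :
    p.1 ≤ |q.1 - q'.1| ∨ p.2 ≤ |q.2 - q'.2| := by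
  rw [disjoint_interior_placedRect_iff] at h
  grind

/-- Stacking `n` copies of a `1 × δ` piece. -/
theorem optPeri_replicate_le {δ : ℝ} (hδ : 0 < δ) {n : ℕ} (hn : n ≠ 0) :
    optPeri (List.replicate n ((1, δ) : Piece)) ≤ 2 * (1 + n * δ) := by
  refine optPeri_le_of_packing (by simpa using hn)
    (fun p hp => by rw [List.eq_of_mem_replicate hp]; exact ⟨one_pos, hδ⟩)
    (pos := fun i => (0, (i : ℕ) * δ)) ?_ ?_ ?_
  · intro i j hij
    rw [disjoint_interior_placedRect_iff]
    right
    have hij' : (i : ℕ) ≠ j := fun h => hij (Fin.ext h)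
    simp only [List.get_eq_getElem, List.getElem_replicate]
    rcases lt_or_gt_of_ne hij' with h | h
    · have : ((i : ℕ) : ℝ) + 1 ≤ (j : ℕ) := by exact_mod_cast h
      exact (min_le_left _ _).trans (le_max_of_le_right (by nlinarith))
    · have : ((j : ℕ) : ℝ) + 1 ≤ (i : ℕ) := by exact_mod_cast h
      exact (min_le_right _ _).trans (le_max_of_le_left (by nlinarith))
  · intro i
    simp
  · intro i
    have h : (i : ℕ) < n := by simpa using i.2
    have : ((i : ℕ) : ℝ) + 1 ≤ n := by exact_mod_cast h
    simp only [List.get_eq_getElem, List.getElem_replicate]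
    exact ⟨by positivity, by nlinarith⟩

/-- Arranging `2 * M` copies of a `1 × δ` piece in two columns below a `2 × δ` piece. -/
theorem optPeri_two_columns_le {δ : ℝ} (hδ : 0 < δ) (M : ℕ) :
    optPeri (List.replicate (2 * M) ((1, δ) : Piece) ++ [(2, δ)]) ≤
      2 * (2 + (M + 1) * δ) := by
  have hget : ∀ i : Fin (List.replicate (2 * M) ((1, δ) : Piece) ++ [(2, δ)]).length,
      (List.replicate (2 * M) ((1, δ) : Piece) ++ [(2, δ)]).get i =
        if (i : ℕ) < 2 * M then (1, δ) else (2, δ) := by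
    intro i
    simp [List.getElem_append]
  have hlt : ∀ i : Fin (List.replicate (2 * M) ((1, δ) : Piece) ++ [(2, δ)]).length,
      (i : ℕ) < 2 * M + 1 := by
    intro i
    simpa using i.2
  have hrow : ∀ {a b : ℕ}, a < b → ((a : ℝ) * δ + δ ≤ b * δ) := by
    intro a b h
    have : (a : ℝ) + 1 ≤ b := by exact_mod_cast h
    nlinarith
  refine optPeri_le_of_packing (by simp) ?_
    (pos := fun i => (((i : ℕ) % 2 : ℕ), ((i : ℕ) / 2 : ℕ) * δ)) ?_ ?_ ?_
  · intro p hp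
    simp only [List.mem_append, List.mem_replicate, List.mem_singleton] at hp
    rcases hp with ⟨-, rfl⟩ | rfl
    · exact ⟨one_pos, hδ⟩
    · exact ⟨two_pos, hδ⟩
  · have key : ∀ i j : Fin (List.replicate (2 * M) ((1, δ) : Piece) ++ [(2, δ)]).length,
        (i : ℕ) < j →
        Disjoint
          (interior (placedRect ((List.replicate (2 * M) ((1, δ) : Piece) ++ [(2, δ)]).get i)
            (((i : ℕ) % 2 : ℕ), ((i : ℕ) / 2 : ℕ) * δ)))
          (interior (placedRect ((List.replicate (2 * M) ((1, δ) : Piece) ++ [(2, δ)]).get j)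
            (((j : ℕ) % 2 : ℕ), ((j : ℕ) / 2 : ℕ) * δ))) := by
      intro i j hij
      have hi := hlt i
      have hj := hlt j
      rw [disjoint_interior_placedRect_iff, hget, hget, if_pos (by omega)]
      rcases lt_or_eq_of_le (Nat.div_le_div_right (c := 2) hij.le) with h | h
      · right
        exact (min_le_left _ _).trans (le_max_of_le_right (hrow h))
      · left
        have h0 : (i : ℕ) % 2 = 0 := by omega
        have h1 : (j : ℕ) % 2 = 1 := by omega
        simp [h0, h1]
    intro i j hij
    rcases lt_or_gt_of_ne (fun h => hij (Fin.ext h)) with h | h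
    · exact key i j h
    · exact (key j i h).symm
  · intro i
    refine ⟨by positivity, ?_⟩
    rw [hget]
    have := hlt i
    split_ifs with h
    · have h2 : (i : ℕ) % 2 + 1 ≤ 2 := by omega
      dsimp only
      exact_mod_cast h2
    · have h2 : (i : ℕ) % 2 + 2 ≤ 2 := by omega
      dsimp only
      exact_mod_cast h2
  · intro i
    have h1 : (((i : ℕ) / 2 : ℕ) : ℝ) * δ + δ ≤ (M + 1 : ℕ) * δ :=
      hrow (by have := hlt i; omega)
    refine ⟨by positivity, ?_⟩
    rw [hget]
    push_cast at h1
    split_ifs <;> exact_mod_cast h1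

/-- For every valid online translation strategy `σ` and every
`ε > 0`, there exists a nonempty finite stream `L` of pieces with
`ALG_σ(L) ≥ (4/3 - ε) * OPT(L)` (perimeter of the bounding box). -/
theorem perimeter_translation_lower_bound
    (σ : List Piece → ℝ × ℝ) (hσ : StrategyValid σ) (ε : ℝ) (hε : 0 < ε) :
    ∃ L : List Piece, L ≠ [] ∧ (∀ p ∈ L, PiecePos p) ∧
      (4 / 3 - ε) * optPeri L ≤ algPeri σ L := by
  obtain ⟨m, hm⟩ := exists_nat_one_div_lt hε
  obtain ⟨M, hM, δ, hδ, hMδ, hδε⟩ : ∃ M : ℕ, 0 < M ∧ ∃ δ : ℝ, 0 < δ ∧ M * δ = 1 ∧ δ ≤ ε :=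
    ⟨m + 1, m.succ_pos, 1 / (m + 1), by positivity, by push_cast; field_simp, hm.le⟩
  have of_bounds : ∀ {L : List Piece} {U : ℝ}, optPeri L ≤ U →
      (4 / 3 - ε) * U ≤ algPeri σ L → (4 / 3 - ε) * optPeri L ≤ algPeri σ L := by
    intro L U h1 h2
    rcases le_total 0 (4 / 3 - ε) with h | h
    · exact (mul_le_mul_of_nonneg_left h1 h).trans h2
    · exact (mul_nonpos_of_nonpos_of_nonneg h (optPeri_nonneg L)).trans (periCost_nonneg _ _)
  set p : Piece := (1, δ) with hp
  set q : ℕ → ℝ × ℝ := fun i => σ (List.replicate (i + 1) p) with hq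
  have hppos : PiecePos p := ⟨one_pos, hδ⟩
  have hrep : ∀ k, ∀ r ∈ List.replicate k p, PiecePos r := fun k r hr => by
    rw [List.eq_of_mem_replicate hr]; exact hppos
  have hqpos : ∀ k (i : Fin (List.replicate k p).length),
      onlinePos σ (List.replicate k p) i = q i := by
    intro k i
    have hi : (i : ℕ) < k := by simpa using i.2
    simp only [onlinePos, hq, List.take_replicate]
    rw [min_eq_left (by omega)]
  have hsep : ∀ i j, i < j → 1 ≤ |(q i).1 - (q j).1| ∨ δ ≤ |(q i).2 - (q j).2| := by
    intro i j hij
    have h := hσ (List.replicate (j + 1) p) (hrep _) ⟨i, by simp; omega⟩ ⟨j, by simp⟩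
      (by simp; omega)
    rw [hqpos, hqpos] at h
    simp only [List.get_eq_getElem, List.getElem_replicate] at h
    exact separated_of_disjoint p _ _ h
  have stacked : ∀ k, (∀ j < k, ∀ i < j, |(q i).1 - (q j).1| < 1) →
      ∀ i ∈ Finset.range k, ∀ j ∈ Finset.range k, i ≠ j → δ ≤ |(q i).2 - (q j).2| := by
    intro k hk i hi j hj hij
    rw [Finset.mem_range] at hi hj
    rcases lt_or_gt_of_ne hij with h | h
    · exact (hsep i j h).resolve_left (hk j hj i h).not_ge
    · rw [abs_sub_comm]
      exact (hsep j i h).resolve_left (hk i hi j h).not_ge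
  by_cases hex : ∃ j, j < 2 * M ∧ ∃ i < j, 1 ≤ |(q i).1 - (q j).1|
  · classical
    obtain ⟨hj, i, hij, hx⟩ := Nat.find_spec hex
    have hmin : ∀ j' < Nat.find hex, ∀ i < j', |(q i).1 - (q j').1| < 1 := by
      intro j' hj' i' hi'
      by_contra! hcon
      exact Nat.find_min hex hj' ⟨hj'.trans hj, i', hi', hcon⟩
    generalize Nat.find hex = j at *
    refine ⟨List.replicate (j + 1) p, by simp, hrep _,
      of_bounds (optPeri_replicate_le hδ (n := j + 1) (by omega)) ?_⟩
    have hb1 := fun k (hk : k < j + 1) => placedRect_fst_bounds (hrep (j + 1))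
      (onlinePos σ _) ⟨k, by simpa using hk⟩
    have hb2 := fun k (hk : k < j + 1) => placedRect_snd_bounds (hrep (j + 1))
      (onlinePos σ _) ⟨k, by simpa using hk⟩
    simp only [hqpos, List.get_eq_getElem, List.getElem_replicate] at hb1 hb2
    have hh := card_mul_le_of_separated (Finset.range j) (fun i => (q i).2) δ _
      (stacked j hmin) (fun k hk => (hb2 k (by simp at hk; omega)).1) _
      (by linarith [hb2 j (by omega)])
      (fun k hk => (hb2 k (by simp at hk; omega)).2)
    rw [Finset.card_range] at hh
    have hw : 2 ≤ boxWidth (packedSet (List.replicate (j + 1) p) (onlinePos σ _)) := by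
      have h1 := hb1 i (by omega)
      have h2 := hb1 j (by omega)
      simp only [hp] at h1 h2
      simp only [boxWidth]
      rcases le_abs.1 hx with h | h <;> linarith
    have hT : ((j : ℝ) + 1) * δ ≤ 2 := by
      have : (j : ℝ) + 1 ≤ 2 * M := by exact_mod_cast hj
      nlinarith
    change _ ≤ 2 * (_ + boxHeight _)
    simp only [boxHeight]
    have : 0 ≤ ε * ((j + 1) * δ) := by positivity
    push_cast
    nlinarith
  · push Not at hex
    have hLpos : ∀ r ∈ List.replicate (2 * M) p ++ [(2, δ)], PiecePos r := by
      intro r hr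
      rcases List.mem_append.1 hr with hr | hr
      · exact hrep _ r hr
      · rw [List.mem_singleton.1 hr]; exact ⟨two_pos, hδ⟩
    refine ⟨List.replicate (2 * M) p ++ [(2, δ)], by simp, hLpos,
      of_bounds (optPeri_two_columns_le hδ M) ?_⟩
    have hw := placedRect_fst_bounds hLpos (onlinePos σ _) ⟨2 * M, by simp⟩
    have hb2 := fun k (hk : k < 2 * M) => placedRect_snd_bounds hLpos
      (onlinePos σ _) ⟨k, by simp; omega⟩
    have hpos : ∀ k (hk : k < 2 * M), onlinePos σ (List.replicate (2 * M) p ++ [(2, δ)])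
        ⟨k, by simp; omega⟩ = q k := by
      intro k hk
      simp only [onlinePos, hq]
      rw [List.take_append_of_le_length (by simp; omega), List.take_replicate,
        min_eq_left (by omega)]
    have hb3 : ∀ k < 2 * M,
        sInf (Prod.snd '' packedSet (List.replicate (2 * M) p ++ [(2, δ)]) (onlinePos σ _)) ≤
          (q k).2 ∧ (q k).2 + δ ≤
        sSup (Prod.snd '' packedSet (List.replicate (2 * M) p ++ [(2, δ)]) (onlinePos σ _)) := by
      intro k hk
      have h := hb2 k hk
      rw [hpos k hk] at h
      simpa [List.getElem_append, hk] using h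
    have hh := card_mul_le_of_separated (Finset.range (2 * M)) (fun i => (q i).2) δ _
      (stacked _ hex) (fun k hk => (hb3 k (by simpa using hk)).1) _
      (by linarith [hb3 0 (by omega)])
      (fun k hk => (hb3 k (by simpa using hk)).2)
    simp only [List.get_eq_getElem] at hw
    rw [List.getElem_append_right (by simp)] at hw
    simp only [List.getElem_singleton] at hw
    rw [Finset.card_range] at hh
    push_cast at hh
    change _ ≤ 2 * (boxWidth _ + boxHeight _)
    simp only [boxWidth, boxHeight]
    have : 0 ≤ ε * δ := by positivity
    nlinarith
end

section
/- For every valid online rotation strategy σ and every ε > 0, there exists a nonempty finite stream L of pieces such that ALG_σ(L) ≥ (5/4 − ε)·OPT(L). (Lower bound of 5/4 on the competitive ratio of any online algorithm for perimeter minimization when rotations by 90° are allowed.) -/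
open Set

/-! ### Bounding boxes of packings -/

lemma orient_pos {p : Piece} (hp : PiecePos p) (r : Bool) : PiecePos (orient p r) := by
  cases r
  · exact hp
  · exact ⟨hp.2, hp.1⟩

lemma orient_unit (r : Bool) : orient (1, 1) r = (1, 1) := by
  cases r <;> rfl

/-- Two positive rectangles with disjoint interiors are separated by a horizontal or a
vertical line. -/
lemma separated_of_disjoint_interior {p p' : Piece} {q q' : ℝ × ℝ} (hp : PiecePos p)
    (hp' : PiecePos p')
    (h : Disjoint (interior (placedRect p q)) (interior (placedRect p' q'))) :
    q.1 + p.1 ≤ q'.1 ∨ q'.1 + p'.1 ≤ q.1 ∨ q.2 + p.2 ≤ q'.2 ∨ q'.2 + p'.2 ≤ q.2 := by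
  by_contra! hc
  obtain ⟨h1, h2, h3, h4⟩ := hc
  obtain ⟨⟨hw, hh⟩, ⟨hw', hh'⟩⟩ := And.intro hp hp'
  obtain ⟨a, ha, ha'⟩ := exists_between
    (show max q.1 q'.1 < min (q.1 + p.1) (q'.1 + p'.1) by
      simp only [max_lt_iff, lt_min_iff]; constructor <;> constructor <;> linarith)
  obtain ⟨b, hb, hb'⟩ := exists_between
    (show max q.2 q'.2 < min (q.2 + p.2) (q'.2 + p'.2) by
      simp only [max_lt_iff, lt_min_iff]; constructor <;> constructor <;> linarith)
  simp only [max_lt_iff, lt_min_iff] at ha ha' hb hb'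
  refine Set.disjoint_left.1 h (show (a, b) ∈ _ from ?_) ?_ <;>
    simp only [placedRect, interior_prod_eq, interior_Icc, mem_prod, mem_Ioo] <;> tauto

/-- Rectangles separated by a horizontal or a vertical line have disjoint interiors. -/
lemma disjoint_interior_of_separated {p p' : Piece} {q q' : ℝ × ℝ}
    (h : q.1 + p.1 ≤ q'.1 ∨ q'.1 + p'.1 ≤ q.1 ∨ q.2 + p.2 ≤ q'.2 ∨ q'.2 + p'.2 ≤ q.2) :
    Disjoint (interior (placedRect p q)) (interior (placedRect p' q')) := by
  refine Set.disjoint_left.2 fun z hz hz' => ?_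
  simp only [placedRect, interior_prod_eq, interior_Icc, mem_prod, mem_Ioo] at hz hz'
  obtain ⟨⟨_, _⟩, _, _⟩ := hz
  obtain ⟨⟨_, _⟩, _, _⟩ := hz'
  rcases h with h | h | h | h <;> linarith

lemma isCompact_packedRotSet (L : List Piece) (pos : Fin L.length → ℝ × ℝ)
    (rot : Fin L.length → Bool) : IsCompact (packedRotSet L pos rot) :=
  isCompact_iUnion fun _ => isCompact_Icc.prod isCompact_Icc

lemma corners_mem_placedRect {p : Piece} (hp : PiecePos p) (q : ℝ × ℝ) :
    q ∈ placedRect p q ∧ (q.1 + p.1, q.2 + p.2) ∈ placedRect p q := by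
  obtain ⟨hw, hh⟩ := hp
  simp [placedRect, Prod.le_def, hw.le, hh.le]

lemma sub_le_sSup_image_sub_sInf_image {α : Type*} [TopologicalSpace α] {S : Set α}
    (hS : IsCompact S) {f : α → ℝ} (hf : Continuous f) {u v : α} (hu : u ∈ S) (hv : v ∈ S) :
    f v - f u ≤ sSup (f '' S) - sInf (f '' S) :=
  sub_le_sub (le_csSup (hS.image hf).bddAbove (mem_image_of_mem f hv))
    (csInf_le (hS.image hf).bddBelow (mem_image_of_mem f hu))

lemma le_boxWidth_packedRotSet {L : List Piece} {pos : Fin L.length → ℝ × ℝ}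
    {rot : Fin L.length → Bool} (hL : ∀ p ∈ L, PiecePos p) (i j : Fin L.length) :
    (pos j).1 + (orient (L.get j) (rot j)).1 - (pos i).1 ≤ boxWidth (packedRotSet L pos rot) :=
  sub_le_sSup_image_sub_sInf_image (isCompact_packedRotSet L pos rot) continuous_fst
    (mem_iUnion.2 ⟨i, (corners_mem_placedRect (orient_pos (hL _ (L.get_mem i)) _) _).1⟩)
    (mem_iUnion.2 ⟨j, (corners_mem_placedRect (orient_pos (hL _ (L.get_mem j)) _) _).2⟩)

lemma le_boxHeight_packedRotSet {L : List Piece} {pos : Fin L.length → ℝ × ℝ}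
    {rot : Fin L.length → Bool} (hL : ∀ p ∈ L, PiecePos p) (i j : Fin L.length) :
    (pos j).2 + (orient (L.get j) (rot j)).2 - (pos i).2 ≤ boxHeight (packedRotSet L pos rot) :=
  sub_le_sSup_image_sub_sInf_image (isCompact_packedRotSet L pos rot) continuous_snd
    (mem_iUnion.2 ⟨i, (corners_mem_placedRect (orient_pos (hL _ (L.get_mem i)) _) _).1⟩)
    (mem_iUnion.2 ⟨j, (corners_mem_placedRect (orient_pos (hL _ (L.get_mem j)) _) _).2⟩)

lemma periRotCost_nonneg (L : List Piece) (pos : Fin L.length → ℝ × ℝ)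
    (rot : Fin L.length → Bool) : 0 ≤ periRotCost L pos rot := by
  have hS := isCompact_packedRotSet L pos rot
  have hw := Real.sInf_le_sSup _ (hS.image continuous_fst).bddBelow
    (hS.image continuous_fst).bddAbove
  have hh := Real.sInf_le_sSup _ (hS.image continuous_snd).bddBelow
    (hS.image continuous_snd).bddAbove
  unfold periRotCost boxWidth boxHeight
  linarith

lemma optRotPeri_le {L : List Piece} {pos : Fin L.length → ℝ × ℝ}
    {rot : Fin L.length → Bool} (h : IsRotPacking L pos rot) :
    optRotPeri L ≤ periRotCost L pos rot := by
  refine csInf_le ⟨0, ?_⟩ ⟨pos, rot, h, rfl⟩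
  rintro _ ⟨pos', rot', -, rfl⟩
  exact periRotCost_nonneg L pos' rot'

/-- A nonempty packing inside `[0, a] × [0, b]` has cost at most `2 * (a + b)`. -/
lemma periRotCost_le {L : List Piece} (hne : L ≠ []) (hL : ∀ p ∈ L, PiecePos p)
    {pos : Fin L.length → ℝ × ℝ} {rot : Fin L.length → Bool} {a b : ℝ}
    (h : ∀ i, 0 ≤ (pos i).1 ∧ (pos i).1 + (orient (L.get i) (rot i)).1 ≤ a ∧
      0 ≤ (pos i).2 ∧ (pos i).2 + (orient (L.get i) (rot i)).2 ≤ b) :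
    periRotCost L pos rot ≤ 2 * (a + b) := by
  have hsub : ∀ z ∈ packedRotSet L pos rot, (0 ≤ z.1 ∧ z.1 ≤ a) ∧ 0 ≤ z.2 ∧ z.2 ≤ b := by
    intro z hz
    obtain ⟨i, ⟨h1, h2⟩, h3, h4⟩ := mem_iUnion.1 hz
    obtain ⟨k1, k2, k3, k4⟩ := h i
    exact ⟨⟨k1.trans h1, h2.trans k2⟩, k3.trans h3, h4.trans k4⟩
  have hS : (packedRotSet L pos rot).Nonempty :=
    let i : Fin L.length := ⟨0, List.length_pos_iff.2 hne⟩
    ⟨pos i, mem_iUnion.2 ⟨i, (corners_mem_placedRect (orient_pos (hL _ (L.get_mem i)) _) _).1⟩⟩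
  have hw1 : sSup (Prod.fst '' packedRotSet L pos rot) ≤ a :=
    csSup_le (hS.image _) (forall_mem_image.2 fun z hz => (hsub z hz).1.2)
  have hw2 : 0 ≤ sInf (Prod.fst '' packedRotSet L pos rot) :=
    le_csInf (hS.image _) (forall_mem_image.2 fun z hz => (hsub z hz).1.1)
  have hh1 : sSup (Prod.snd '' packedRotSet L pos rot) ≤ b :=
    csSup_le (hS.image _) (forall_mem_image.2 fun z hz => (hsub z hz).2.2)
  have hh2 : 0 ≤ sInf (Prod.snd '' packedRotSet L pos rot) :=
    le_csInf (hS.image _) (forall_mem_image.2 fun z hz => (hsub z hz).2.1)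
  unfold periRotCost boxWidth boxHeight
  linarith

/-! ### The two adversarial streams -/

/-- Three unit squares followed by `p`. -/
def squaresThen (p : Piece) : List Piece := [(1, 1), (1, 1), (1, 1), p]

lemma squaresThen_pos {p : Piece} (hp : PiecePos p) : ∀ q ∈ squaresThen p, PiecePos q := by
  simp [squaresThen, PiecePos, hp.1, hp.2]

/-- An unrotated packing of `squaresThen p` inside `[0, a] × [0, b]` bounds the optimum. -/
lemma optRotPeri_squaresThen_le {p : Piece} (hp : PiecePos p) {pos : Fin 4 → ℝ × ℝ}
    {size : Fin 4 → Piece} (hsize : size = ![(1, 1), (1, 1), (1, 1), p]) {a b : ℝ}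
    (hsep : ∀ i j, i ≠ j →
      (pos i).1 + (size i).1 ≤ (pos j).1 ∨ (pos j).1 + (size j).1 ≤ (pos i).1 ∨
      (pos i).2 + (size i).2 ≤ (pos j).2 ∨ (pos j).2 + (size j).2 ≤ (pos i).2)
    (hbox : ∀ i, 0 ≤ (pos i).1 ∧ (pos i).1 + (size i).1 ≤ a ∧
      0 ≤ (pos i).2 ∧ (pos i).2 + (size i).2 ≤ b) :
    optRotPeri (squaresThen p) ≤ 2 * (a + b) := by
  have hs : (fun i => orient ((squaresThen p).get i) false) = size := by
    rw [hsize]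
    funext i
    fin_cases i <;> rfl
  subst hs
  exact (optRotPeri_le (L := squaresThen p) (pos := pos) (rot := fun _ => false)
    fun i j hij => disjoint_interior_of_separated (hsep i j hij)).trans
    (periRotCost_le (by simp [squaresThen]) (squaresThen_pos hp) hbox)

/-- Four unit squares form a square of side `2`. -/
lemma optRotPeri_four_squares_le : optRotPeri (squaresThen (1, 1)) ≤ 8 := by
  refine (optRotPeri_squaresThen_le ⟨one_pos, one_pos⟩
    (pos := ![(0, 0), (1, 0), (0, 1), (1, 1)]) (a := 2) (b := 2) rfl
    (fun i j hij => ?_) fun i => ?_).trans (by norm_num)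
  · fin_cases i <;> fin_cases j <;> first | exact absurd rfl hij | norm_num
  · fin_cases i <;> norm_num

/-- A strip of length `3` can be stacked on a row of three unit squares. -/
lemma optRotPeri_squares_strip_le {δ : ℝ} (hδ : 0 < δ) :
    optRotPeri (squaresThen (3, δ)) ≤ 2 * (4 + δ) := by
  refine (optRotPeri_squaresThen_le ⟨three_pos, hδ⟩
    (pos := ![(0, 0), (1, 0), (2, 0), (0, 1)]) (a := 3) (b := 1 + δ) rfl
    (fun i j hij => ?_) fun i => ?_).trans (by linarith)
  · fin_cases i <;> fin_cases j <;> first | exact absurd rfl hij | norm_num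
  · fin_cases i <;> norm_num [hδ.le]

/-- The online cost after `squaresThen p` dominates the extent of any pair of pieces, and the
pieces are pairwise separated; the first three positions do not depend on `p`. -/
lemma algRotPeri_squaresThen {σ : List Piece → (ℝ × ℝ) × Bool} (hσ : RotStrategyValid σ)
    {p : Piece} (hp : PiecePos p) :
    ∃ W H : ℝ, algRotPeri σ (squaresThen p) = 2 * (W + H) ∧
      ∃ pos : Fin 4 → ℝ × ℝ, ∃ size : Fin 4 → Piece,
        pos = ![(σ [(1, 1)]).1, (σ [(1, 1), (1, 1)]).1, (σ [(1, 1), (1, 1), (1, 1)]).1,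
          (σ (squaresThen p)).1] ∧
        size = ![(1, 1), (1, 1), (1, 1), orient p (σ (squaresThen p)).2] ∧
        (∀ i j, (pos j).1 + (size j).1 - (pos i).1 ≤ W) ∧
        (∀ i j, (pos j).2 + (size j).2 - (pos i).2 ≤ H) ∧
        ∀ i j, i ≠ j → (pos i).1 + (size i).1 ≤ (pos j).1 ∨ (pos j).1 + (size j).1 ≤ (pos i).1 ∨
          (pos i).2 + (size i).2 ≤ (pos j).2 ∨ (pos j).2 + (size j).2 ≤ (pos i).2 := by
  have hL := squaresThen_pos hp
  refine ⟨_, _, rfl, onlineRotPos σ (squaresThen p),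
    fun i => orient ((squaresThen p).get i) (onlineRot σ (squaresThen p) i), ?_, ?_,
    le_boxWidth_packedRotSet hL, le_boxHeight_packedRotSet hL, fun i j hij => ?_⟩
  · funext i
    fin_cases i <;> rfl
  · funext i
    fin_cases i <;> [exact orient_unit _; exact orient_unit _; exact orient_unit _; rfl]
  · exact separated_of_disjoint_interior (orient_pos (hL _ ((squaresThen p).get_mem i)) _)
      (orient_pos (hL _ ((squaresThen p).get_mem j)) _) (hσ _ hL i j hij)

/-- If the first three of four unit squares are stacked in a column of width less than `2`,
then the half-perimeter is at least `5`. -/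
lemma five_le_of_column {x y : Fin 4 → ℝ} {W H : ℝ}
    (hW : ∀ i j, x j + 1 - x i ≤ W) (hH : ∀ i j, y j + 1 - y i ≤ H)
    (hsep : ∀ i j, i ≠ j → x i + 1 ≤ x j ∨ x j + 1 ≤ x i ∨ y i + 1 ≤ y j ∨ y j + 1 ≤ y i)
    (h : ∀ i j, i ≠ 3 → j ≠ 3 → x i < x j + 1) : 5 ≤ W + H := by
  have hy : ∀ i j, i ≠ 3 → j ≠ 3 → i ≠ j → y i + 1 ≤ y j ∨ y j + 1 ≤ y i := by
    intro i j hi hj hij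
    have h1 := h i j hi hj
    have h2 := h j i hj hi
    rcases hsep i j hij with h | h | h | h
    · linarith
    · linarith
    · exact .inl h
    · exact .inr h
  have h01 := hy 0 1 (by decide) (by decide) (by decide)
  have h02 := hy 0 2 (by decide) (by decide) (by decide)
  have h12 := hy 1 2 (by decide) (by decide) (by decide)
  have hH3 : 3 ≤ H := by
    have := hH 0 1; have := hH 1 0; have := hH 0 2; have := hH 2 0; have := hH 1 2
    have := hH 2 1
    rcases h01 with _ | _ <;> rcases h02 with _ | _ <;> rcases h12 with _ | _ <;> linarith
  by_contra! hlt
  have hx : ∀ i, i ≠ 3 → y i + 1 ≤ y 3 ∨ y 3 + 1 ≤ y i := by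
    intro i hi
    have := hW i 3
    have := hW 3 i
    rcases hsep i 3 hi with h | h | h | h
    · linarith
    · linarith
    · exact .inl h
    · exact .inr h
  have h0 := hx 0 (by decide)
  have h1 := hx 1 (by decide)
  have h2 := hx 2 (by decide)
  have hW1 := hW 0 0
  have hHlt : H < 4 := by linarith
  have hy' : ∀ i j, y j < y i + 3 := fun i j => by linarith [hH i j]
  have := hy' 0 1; have := hy' 1 0; have := hy' 0 2; have := hy' 2 0; have := hy' 1 2
  have := hy' 2 1; have := hy' 0 3; have := hy' 3 0; have := hy' 1 3; have := hy' 3 1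
  have := hy' 2 3; have := hy' 3 2
  rcases h01 with _ | _ <;> rcases h02 with _ | _ <;> rcases h12 with _ | _ <;>
    rcases h0 with _ | _ <;> rcases h1 with _ | _ <;> rcases h2 with _ | _ <;> linarith

/-- If the first three squares are stacked in a single row or column, a fourth square forces
cost at least `10`. -/
lemma ten_le_algRotPeri_four_squares {σ : List Piece → (ℝ × ℝ) × Bool}
    (hσ : RotStrategyValid σ) {q : Fin 3 → ℝ × ℝ}
    (hq : q = ![(σ [(1, 1)]).1, (σ [(1, 1), (1, 1)]).1, (σ [(1, 1), (1, 1), (1, 1)]).1])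
    (h : (∀ i j, (q i).1 < (q j).1 + 1) ∨ ∀ i j, (q i).2 < (q j).2 + 1) :
    10 ≤ algRotPeri σ (squaresThen (1, 1)) := by
  obtain ⟨W, H, hcost, pos, size, hpos, hsize, hW, hH, hsep⟩ :=
    algRotPeri_squaresThen hσ (p := (1, 1)) ⟨one_pos, one_pos⟩
  have hs : ∀ i, size i = (1, 1) := by
    intro i
    rw [hsize, orient_unit]
    fin_cases i <;> rfl
  simp only [hs] at hW hH hsep
  have hpq : ∀ i : Fin 4, i ≠ 3 → ∃ k, pos i = q k := by
    intro i hi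
    rw [hpos, hq]
    fin_cases i
    exacts [⟨0, rfl⟩, ⟨1, rfl⟩, ⟨2, rfl⟩, absurd rfl hi]
  have key : 5 ≤ W + H := by
    rcases h with h | h
    · refine five_le_of_column hW hH hsep fun i j hi hj => ?_
      obtain ⟨k, hk⟩ := hpq i hi
      obtain ⟨l, hl⟩ := hpq j hj
      simpa only [hk, hl] using h k l
    · rw [add_comm]
      refine five_le_of_column hH hW (fun i j hij => ?_) fun i j hi hj => ?_
      · have := hsep i j hij
        tauto
      · obtain ⟨k, hk⟩ := hpq i hi
        obtain ⟨l, hl⟩ := hpq j hj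
        simpa only [hk, hl] using h k l
  rw [hcost]
  linarith

/-- If the first three squares span at least `2` in both directions, a strip of length `3`
forces cost at least `10`. -/
lemma ten_le_algRotPeri_squares_strip {σ : List Piece → (ℝ × ℝ) × Bool}
    (hσ : RotStrategyValid σ) {q : Fin 3 → ℝ × ℝ}
    (hq : q = ![(σ [(1, 1)]).1, (σ [(1, 1), (1, 1)]).1, (σ [(1, 1), (1, 1), (1, 1)]).1])
    (hx : ∃ i j, (q j).1 + 1 ≤ (q i).1) (hy : ∃ i j, (q j).2 + 1 ≤ (q i).2)
    {δ : ℝ} (hδ : 0 < δ) :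
    10 ≤ algRotPeri σ (squaresThen (3, δ)) := by
  obtain ⟨W, H, hcost, pos, size, hpos, hsize, hW, hH, -⟩ :=
    algRotPeri_squaresThen hσ (p := (3, δ)) ⟨three_pos, hδ⟩
  have hpq : ∀ k : Fin 3, ∃ i, pos i = q k ∧ size i = (1, 1) := by
    intro k
    refine ⟨k.castSucc, ?_, ?_⟩
    · rw [hpos, hq]
      fin_cases k <;> rfl
    · rw [hsize]
      fin_cases k <;> rfl
  have hW2 : 2 ≤ W := by
    obtain ⟨k, l, hkl⟩ := hx
    obtain ⟨i, hi, hi'⟩ := hpq k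
    obtain ⟨j, hj, -⟩ := hpq l
    have := hW j i
    rw [hi, hi', hj] at this
    linarith
  have hH2 : 2 ≤ H := by
    obtain ⟨k, l, hkl⟩ := hy
    obtain ⟨i, hi, hi'⟩ := hpq k
    obtain ⟨j, hj, -⟩ := hpq l
    have := hH j i
    rw [hi, hi', hj] at this
    linarith
  have hs : size 3 = orient (3, δ) (σ (squaresThen (3, δ))).2 := by
    rw [hsize]
    rfl
  have h3W := hW 3 3
  have h3H := hH 3 3
  rw [hcost]
  rw [hs] at h3W h3H
  cases hr : (σ (squaresThen (3, δ))).2 <;> simp [hr, orient] at h3W h3H <;> linarith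

/-- For every valid online rotation strategy `σ` and every
`ε > 0`, there exists a nonempty finite stream `L` of pieces with
`ALG_σ(L) ≥ (5/4 - ε) * OPT(L)` (perimeter of the bounding box, rotations by
90° allowed). -/
theorem perimeter_rotation_lower_bound
    (σ : List Piece → (ℝ × ℝ) × Bool) (hσ : RotStrategyValid σ)
    (ε : ℝ) (hε : 0 < ε) :
    ∃ L : List Piece, L ≠ [] ∧ (∀ p ∈ L, PiecePos p) ∧
      (5 / 4 - ε) * optRotPeri L ≤ algRotPeri σ L := by
  by_cases hneg : 5 / 4 - ε ≤ 0
  · exact ⟨squaresThen (1, 1), by simp [squaresThen], squaresThen_pos ⟨one_pos, one_pos⟩,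
      (mul_nonpos_of_nonpos_of_nonneg hneg (Real.sInf_nonneg (by
        rintro _ ⟨pos, rot, -, rfl⟩
        exact periRotCost_nonneg _ pos rot))).trans (periRotCost_nonneg _ _ _)⟩
  push Not at hneg
  obtain ⟨q, hq⟩ : ∃ q : Fin 3 → ℝ × ℝ,
      q = ![(σ [(1, 1)]).1, (σ [(1, 1), (1, 1)]).1, (σ [(1, 1), (1, 1), (1, 1)]).1] := ⟨_, rfl⟩
  by_cases h : (∀ i j, (q i).1 < (q j).1 + 1) ∨ ∀ i j, (q i).2 < (q j).2 + 1
  · refine ⟨squaresThen (1, 1), by simp [squaresThen], squaresThen_pos ⟨one_pos, one_pos⟩, ?_⟩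
    have hopt := mul_le_mul_of_nonneg_left optRotPeri_four_squares_le hneg.le
    linarith [ten_le_algRotPeri_four_squares hσ hq h]
  · push Not at h
    refine ⟨squaresThen (3, ε), by simp [squaresThen], squaresThen_pos ⟨three_pos, hε⟩, ?_⟩
    have hopt := mul_le_mul_of_nonneg_left (optRotPeri_squares_strip_le hε) hneg.le
    nlinarith [ten_le_algRotPeri_squares_strip hσ hq h.1 h.2 hε]
end
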